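/- There exist constants α > 0 and C < ∞ such that uniformly for integers 1 ≤ l ≤ n/2, P(ζ(π/2,l,n)) ≤ C·(n/l)^{−α}·P(ζ(π,l,n)). -/

import Mathlib

/-!
Critical site percolation on the triangular lattice realized on `ℤ²`.
A configuration assigns to each site `true` (open) or `false` (closed),
and `P` is the product Bernoulli(1/2) measure, axiomatized by
`IsBernoulliHalf` below (finite cylinder events have product probability).
-/

open MeasureTheory
open scoped ENNReal

/-- Sites of the lattice: vertices of `ℤ²`. -/
abbrev Site : Type := ℤ × ℤ

/-- A percolation configuration: `true` = open, `false` = closed. -/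
abbrev Config : Type := Site → Bool

/-- Adjacency for the triangular lattice realized on `ℤ²`:
the neighbors of `(x,y)` are `(x±1,y)`, `(x,y±1)`, `(x+1,y-1)`, `(x-1,y+1)`. -/
def Adj (a b : Site) : Prop :=
  (b.1 - a.1, b.2 - a.2) ∈
    ({(1, 0), (-1, 0), (0, 1), (0, -1), (1, -1), (-1, 1)} : Set (ℤ × ℤ))

/-- A (nonempty, self-avoiding) lattice path: a list of distinct sites in which
consecutive sites are neighbors. -/
def IsPath (p : List Site) : Prop := p ≠ [] ∧ p.Nodup ∧ p.Chain' Adj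

/-- A path all of whose vertices lie in the set `S`. -/
def PathIn (S : Set Site) (p : List Site) : Prop := IsPath p ∧ ∀ v ∈ p, v ∈ S

/-- All sites of `p` are open in `ω`. -/
def IsOpenOn (ω : Config) (p : List Site) : Prop := ∀ v ∈ p, ω v = true

/-- All sites of `p` are closed in `ω`. -/
def IsClosedOn (ω : Config) (p : List Site) : Prop := ∀ v ∈ p, ω v = false

/-- The first vertex of `p` lies in `A`. -/
def FirstIn (A : Set Site) (p : List Site) : Prop := ∃ a ∈ A, p.head? = some a

/-- The last vertex of `p` lies in `A`. -/
def LastIn (A : Set Site) (p : List Site) : Prop := ∃ a ∈ A, p.getLast? = some a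

/-- `μ` is the product Bernoulli(1/2) measure on configurations: a probability
measure for which every finite cylinder event has the product probability. -/
def IsBernoulliHalf (μ : Measure Config) : Prop :=
  IsProbabilityMeasure μ ∧
    ∀ (S : Finset Site) (f : Site → Bool),
      μ {ω | ∀ v ∈ S, ω v = f v} = (1 / 2 : ℝ≥0∞) ^ S.card

/-- The lattice rectangle `[x₀,x₁] × [y₀,y₁]`. -/
def rect (x₀ x₁ y₀ y₁ : ℤ) : Set Site :=
  {v | x₀ ≤ v.1 ∧ v.1 ≤ x₁ ∧ y₀ ≤ v.2 ∧ v.2 ≤ y₁}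

/-- The left side of a rectangle. -/
def rectLeft (x₀ x₁ y₀ y₁ : ℤ) : Set Site := {v ∈ rect x₀ x₁ y₀ y₁ | v.1 = x₀}

/-- The right side of a rectangle. -/
def rectRight (x₀ x₁ y₀ y₁ : ℤ) : Set Site := {v ∈ rect x₀ x₁ y₀ y₁ | v.1 = x₁}

/-- The top side of a rectangle. -/
def rectTop (x₀ x₁ y₀ y₁ : ℤ) : Set Site := {v ∈ rect x₀ x₁ y₀ y₁ | v.2 = y₁}

/-- The bottom side of a rectangle. -/
def rectBot (x₀ x₁ y₀ y₁ : ℤ) : Set Site := {v ∈ rect x₀ x₁ y₀ y₁ | v.2 = y₀}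

/-- A horizontal open crossing of the rectangle `[x₀,x₁] × [y₀,y₁]`:
an open path in the rectangle from its left side to its right side. -/
def HorizCrossing (x₀ x₁ y₀ y₁ : ℤ) (ω : Config) (p : List Site) : Prop :=
  PathIn (rect x₀ x₁ y₀ y₁) p ∧ IsOpenOn ω p ∧
    FirstIn (rectLeft x₀ x₁ y₀ y₁) p ∧ LastIn (rectRight x₀ x₁ y₀ y₁) p

/-- The sector `S(π/2, n)` of aperture `π/2` inside `B(n)`: the part of `B(n)`
in the first quadrant. -/
def sectorQ (n : ℤ) : Set Site := {v | 0 ≤ v.1 ∧ v.1 ≤ n ∧ 0 ≤ v.2 ∧ v.2 ≤ n}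

/-- The sector `S(π, n)` of aperture `π` inside `B(n)`: the part of `B(n)`
in the upper half plane. -/
def sectorH (n : ℤ) : Set Site := {v | -n ≤ v.1 ∧ v.1 ≤ n ∧ 0 ≤ v.2 ∧ v.2 ≤ n}

/-- `K₁ = {(l,y) : 3l/8 ≤ y ≤ 5l/8}`. -/
def K1 (l : ℤ) : Set Site := {v | v.1 = l ∧ 3 * l ≤ 8 * v.2 ∧ 8 * v.2 ≤ 5 * l}

/-- `K₂ = {(x,l) : l/4 ≤ x ≤ 3l/4}`. -/
def K2 (l : ℤ) : Set Site := {v | v.2 = l ∧ l ≤ 4 * v.1 ∧ 4 * v.1 ≤ 3 * l}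

/-- The boundary `∂B(n)` of the box `B(n)`. -/
def boxBdry (n : ℤ) : Set Site :=
  {v ∈ rect (-n) n (-n) n | v.1 = -n ∨ v.1 = n ∨ v.2 = -n ∨ v.2 = n}

/-- The path `p` starts from the set `K`: its first vertex lies in `K` or is
adjacent to a site of `K`. -/
def StartNear (K : Set Site) (p : List Site) : Prop :=
  ∃ h, p.head? = some h ∧ (h ∈ K ∨ ∃ u ∈ K, Adj u h)

/-- `ζ(φ,l,n)` for the sector family `sector`: there is a closed path in
`S(φ,n) \ S(φ,l)` from `K₁` to `∂B(n)` and an open path in `S(φ,n) \ S(φ,l)`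
from `K₂` to `∂B(n)`. -/
def zeta (sector : ℤ → Set Site) (l n : ℤ) (ω : Config) : Prop :=
  (∃ p, PathIn (sector n \ sector l) p ∧ IsClosedOn ω p ∧
      StartNear (K1 l) p ∧ LastIn (boxBdry n) p) ∧
  (∃ p, PathIn (sector n \ sector l) p ∧ IsOpenOn ω p ∧
      StartNear (K2 l) p ∧ LastIn (boxBdry n) p)

open Relation in
/-- `a` and `b` are connected by a lattice path inside `S`. -/
def Conn (S : Set Site) (a b : Site) : Prop :=
  a ∈ S ∧ ReflTransGen (fun u v => Adj u v ∧ v ∈ S) a b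

theorem adj_iff {a b : Site} : Adj a b ↔
    (b.1 = a.1 + 1 ∧ b.2 = a.2) ∨ (b.1 = a.1 - 1 ∧ b.2 = a.2) ∨ (b.1 = a.1 ∧ b.2 = a.2 + 1) ∨
      (b.1 = a.1 ∧ b.2 = a.2 - 1) ∨ (b.1 = a.1 + 1 ∧ b.2 = a.2 - 1) ∨
      (b.1 = a.1 - 1 ∧ b.2 = a.2 + 1) := by
  simp only [Adj, Set.mem_insert_iff, Set.mem_singleton_iff, Prod.mk.injEq]
  omega

theorem Adj.symm {a b : Site} (h : Adj a b) : Adj b a := by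
  rw [adj_iff] at *
  omega

namespace Conn

variable {S S' X : Set Site} {a b c : Site}

theorem refl (h : a ∈ S) : Conn S a a := ⟨h, .refl⟩

theorem mem_left (h : Conn S a b) : a ∈ S := h.1

theorem mem_right (h : Conn S a b) : b ∈ S := by
  rcases h.2.cases_tail with h' | ⟨_, _, h'⟩
  · exact h' ▸ h.1
  · exact h'.2

theorem tail (h : Conn S a b) (hbc : Adj b c) (hc : c ∈ S) : Conn S a c :=
  ⟨h.1, h.2.tail ⟨hbc, hc⟩⟩

theorem trans (h : Conn S a b) (h' : Conn S b c) : Conn S a c := ⟨h.1, h.2.trans h'.2⟩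

theorem induct {P : Site → Prop} (h : Conn S a b) (h0 : P a)
    (hs : ∀ u v, Conn S a u → P u → Adj u v → v ∈ S → P v) : P b := by
  obtain ⟨ha, h⟩ := h
  induction h with
  | refl => exact h0
  | tail h1 h2 ih => exact hs _ _ ⟨ha, h1⟩ ih h2.1 h2.2

theorem head (hab : Adj a b) (ha : a ∈ S) (h : Conn S b c) : Conn S a c :=
  ((refl ha).tail hab h.1).trans h

theorem symm (h : Conn S a b) : Conn S b a :=
  h.induct (P := fun v => Conn S v a) (refl h.1) fun _ _ _ ih huv hv => head huv.symm hv ih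

theorem mono (h : Conn S a b) (hS : S ⊆ S') : Conn S' a b :=
  h.induct (P := fun v => Conn S' a v) (refl (hS h.1)) fun _ _ _ ih huv hv => ih.tail huv (hS hv)

theorem cluster (h : Conn S a b) : Conn {v | Conn S a v} a b :=
  h.induct (P := fun v => Conn {v | Conn S a v} a v) (refl (refl h.1))
    fun _ _ hu ih huv hv => ih.tail huv (hu.tail huv hv)

theorem exit (h : Conn S a b) (ha : a ∈ X) (hb : b ∉ X) :
    ∃ c d, Conn (S ∩ X) a c ∧ Adj c d ∧ d ∈ S ∧ d ∉ X := by
  have key : Conn (S ∩ X) a b ∨ ∃ c d, Conn (S ∩ X) a c ∧ Adj c d ∧ d ∈ S ∧ d ∉ X := by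
    refine h.induct (P := fun v => Conn (S ∩ X) a v ∨ _) (.inl (refl ⟨h.1, ha⟩)) ?_
    rintro u v - (hu | hu) huv hv
    · by_cases hvX : v ∈ X
      · exact .inl (hu.tail huv ⟨hv, hvX⟩)
      · exact .inr ⟨u, v, hu, huv, hv, hvX⟩
    · exact .inr hu
  rcases key with h' | h'
  · exact absurd h'.mem_right.2 hb
  · exact h'

theorem last_exit (h : Conn S a b) (ha : a ∈ X) (hb : b ∉ X) :
    ∃ c d, c ∈ S ∧ c ∈ X ∧ Adj c d ∧ Conn (S \ X) d b := by
  obtain ⟨c, d, h1, h2, h3, h4⟩ := h.symm.exit (X := Xᶜ) hb (by simpa using ha)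
  exact ⟨d, c, h3, by simpa using h4, h2.symm, h1.symm⟩

theorem hseg {x₀ x₁ y : ℤ} (h : x₀ ≤ x₁) (hS : ∀ x, x₀ ≤ x → x ≤ x₁ → (x, y) ∈ S) :
    Conn S (x₀, y) (x₁, y) := by
  induction x₁, h using Int.leInduction with
  | base => exact refl (hS _ le_rfl le_rfl)
  | succ k hk ih =>
    exact (ih fun x h1 h2 => hS x h1 (by omega)).tail (by rw [adj_iff]; simp)
      (hS _ (by omega) le_rfl)

theorem vseg {y₀ y₁ x : ℤ} (h : y₀ ≤ y₁) (hS : ∀ y, y₀ ≤ y → y ≤ y₁ → (x, y) ∈ S) :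
    Conn S (x, y₀) (x, y₁) := by
  induction y₁, h using Int.leInduction with
  | base => exact refl (hS _ le_rfl le_rfl)
  | succ k hk ih =>
    exact (ih fun x h1 h2 => hS x h1 (by omega)).tail (by rw [adj_iff]; simp)
      (hS _ (by omega) le_rfl)

/-- A connection along which an integer function with increments at most one
goes from `≤ m` to `≥ M` contains one on which it stays in `[m, M]`. -/
theorem truncate {f : Site → ℤ} (hf : ∀ u v, Adj u v → f v ≤ f u + 1) {m M : ℤ} (hmM : m ≤ M)
    (h : Conn S a b) (ha : f a ≤ m) (hb : M ≤ f b) :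
    ∃ a' b', f a' = m ∧ f b' = M ∧ Conn (S ∩ {v | m ≤ f v ∧ f v ≤ M}) a' b' := by
  obtain ⟨a', ha', h'⟩ : ∃ a', f a' = m ∧ Conn (S ∩ {v | m ≤ f v}) a' b := by
    by_cases hbm : m ≤ f b
    · rcases ha.eq_or_lt with ha | ha
      · by_cases hall : Conn (S ∩ {v | m ≤ f v}) a b
        · exact ⟨a, ha, hall⟩
        · have hex : ∃ w, Conn S a w ∧ f w < m ∧ Conn S w b := by
            by_contra hcon
            push Not at hcon
            apply hall
            have : Conn {v | Conn S a v ∧ Conn S v b} a b := by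
              have h2 := h.cluster
              refine h2.mono fun v hv => ⟨hv, hv.symm.trans h⟩
            exact this.mono fun v hv => ⟨hv.1.mem_right, not_lt.1 fun hlt => hcon v hv.1 hlt hv.2⟩
          obtain ⟨w, -, hw, hwb⟩ := hex
          obtain ⟨c, d, hc, hcX, hcd, hd⟩ := hwb.last_exit (X := {v | f v < m}) hw
            (by simpa using hbm)
          refine ⟨d, ?_, hd.mono fun v hv => ⟨hv.1, by simpa using hv.2⟩⟩
          have := hf _ _ hcd
          have := hd.mem_left.2
          simp only [Set.mem_ofPred_eq] at *
          omega
      · obtain ⟨c, d, hc, hcX, hcd, hd⟩ := h.last_exit (X := {v | f v < m}) ha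
            (by simpa using hbm)
        refine ⟨d, ?_, hd.mono fun v hv => ⟨hv.1, by simpa using hv.2⟩⟩
        have := hf _ _ hcd
        have := hd.mem_left.2
        simp only [Set.mem_ofPred_eq] at *
        omega
    · omega
  by_cases ha'M : f a' = M
  · exact ⟨a', a', ha', ha'M, refl ⟨h'.1.1, h'.1.2, ha'M.le⟩⟩
  · obtain ⟨c, d, hc, hcd, hd, hdX⟩ := h'.exit (X := {v | f v < M})
      (by simp only [Set.mem_ofPred_eq]; omega) (by simpa using hb)
    have hcM := hc.mem_right.2
    have := hf _ _ hcd
    have := hd.2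
    simp only [Set.mem_ofPred_eq] at *
    refine ⟨a', d, ha', by omega, (hc.mono ?_).tail hcd ⟨hd.1, hd.2, by omega⟩⟩
    rintro v ⟨⟨h1, h2⟩, h3⟩
    exact ⟨h1, h2, le_of_lt h3⟩

end Conn

theorem parity_step (b c : Site) (hbc : (c.1 = b.1 + 1 ∧ c.2 = b.2) ∨ (c.1 = b.1 - 1 ∧ c.2 = b.2) ∨
    (c.1 = b.1 ∧ c.2 = b.2 + 1) ∨ (c.1 = b.1 ∧ c.2 = b.2 - 1) ∨
    (c.1 = b.1 + 1 ∧ c.2 = b.2 - 1) ∨ (c.1 = b.1 - 1 ∧ c.2 = b.2 + 1)) (x y y' : ℤ)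
    (hy : y' = y ∨ y' = y - 1) (h1 : ¬ (x = b.1 ∧ y = b.2)) (h2 : ¬ (x = c.1 ∧ y = c.2))
    (h3 : ¬ (x + 1 = b.1 ∧ y' = b.2)) (h4 : ¬ (x + 1 = c.1 ∧ y' = c.2)) :
    (if b.1 = x + 1 ∧ y' < b.2 then (1 : ZMod 2) else 0) +
      ((if (b.1 = x ∧ c.1 = x + 1 ∧ y < b.2) ∨ (c.1 = x ∧ b.1 = x + 1 ∧ y < c.2) then 1 else 0) +
      if (b.1 = x + 1 ∧ c.1 = x + 1 + 1 ∧ y' < b.2) ∨ (c.1 = x + 1 ∧ b.1 = x + 1 + 1 ∧ y' < c.2)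
        then 1 else 0) = if c.1 = x + 1 ∧ y' < c.2 then 1 else 0 := by
  obtain ⟨b1, b2⟩ := b
  obtain ⟨c1, c2⟩ := c
  simp only at *
  rcases hbc with ⟨rfl, rfl⟩ | ⟨rfl, rfl⟩ | ⟨rfl, rfl⟩ | ⟨rfl, rfl⟩ | ⟨rfl, rfl⟩ | ⟨rfl, rfl⟩ <;>
    rcases hy with rfl | rfl <;> split_ifs <;> first | (exfalso; omega) | rfl

/-- The parity, for each site, of the number of steps of a path that pass above it. -/
theorem Conn.exists_parity {S : Set Site} {a b : Site} (h : Conn S a b) :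
    ∃ F : Site → ZMod 2,
      (∀ x y, (x, y) ∉ S → (x, y + 1) ∉ S → F (x, y) = F (x, y + 1)) ∧
      (∀ x y y', (y' = y ∨ y' = y - 1) → (x, y) ∉ S → (x + 1, y') ∉ S →
        F (x, y) + F (x + 1, y') =
          (if a.1 = x + 1 ∧ y' < a.2 then 1 else 0) + if b.1 = x + 1 ∧ y' < b.2 then 1 else 0) ∧
      (∀ m v, (∀ s ∈ S, m ≤ s.2) → v ∉ S → v.2 ≤ m →
        F v = (if a.1 ≤ v.1 then 1 else 0) + if b.1 ≤ v.1 then 1 else 0) ∧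
      (∀ M v, (∀ s ∈ S, s.2 ≤ M) → M ≤ v.2 → F v = 0) := by
  have two : (1 : ZMod 2) + 1 = 0 := by decide
  refine h.induct (P := fun b => ∃ F : Site → ZMod 2,
      (∀ x y, (x, y) ∉ S → (x, y + 1) ∉ S → F (x, y) = F (x, y + 1)) ∧
      (∀ x y y', (y' = y ∨ y' = y - 1) → (x, y) ∉ S → (x + 1, y') ∉ S →
        F (x, y) + F (x + 1, y') =
          (if a.1 = x + 1 ∧ y' < a.2 then 1 else 0) + if b.1 = x + 1 ∧ y' < b.2 then 1 else 0) ∧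
      (∀ m v, (∀ s ∈ S, m ≤ s.2) → v ∉ S → v.2 ≤ m →
        F v = (if a.1 ≤ v.1 then 1 else 0) + if b.1 ≤ v.1 then 1 else 0) ∧
      (∀ M v, (∀ s ∈ S, s.2 ≤ M) → M ≤ v.2 → F v = 0)) ⟨fun _ => 0, ?_, ?_, ?_, ?_⟩ ?_
  · intros; rfl
  · intros; split_ifs <;> simp [two]
  · intros; split_ifs <;> simp [two]
  · intros; rfl
  · rintro b c hb ⟨F, h1, h2, h3, h4⟩ hbc hc
    have hbS := hb.mem_right
    have hne : ∀ v ∉ S, ¬ (v.1 = b.1 ∧ v.2 = b.2) ∧ ¬ (v.1 = c.1 ∧ v.2 = c.2) := fun v hv =>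
      ⟨fun h => hv (Prod.ext h.1 h.2 ▸ hbS), fun h => hv (Prod.ext h.1 h.2 ▸ hc)⟩
    rw [adj_iff] at hbc
    refine ⟨fun v => F v + if (b.1 = v.1 ∧ c.1 = v.1 + 1 ∧ v.2 < b.2) ∨
      (c.1 = v.1 ∧ b.1 = v.1 + 1 ∧ v.2 < c.2) then 1 else 0, ?_, ?_, ?_, ?_⟩
    · intro x y hv hw
      simp only [h1 x y hv hw]
      congr 1
      have := hne _ hv
      have := hne _ hw
      simp only at *
      split_ifs <;> first | rfl | omega
    · intro x y y' hy hv hw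
      have h0 := h2 x y y' hy hv hw
      have h5 := hne _ hv
      have h6 := hne _ hw
      simp only at h5 h6 ⊢
      rw [add_add_add_comm, h0, add_assoc]
      congr 1
      exact parity_step b c hbc x y y' hy h5.1 h5.2 h6.1 h6.2
    · intro m v hS hv hm
      simp only [h3 m v hS hv hm, add_assoc]
      have := hne _ hv
      have := hS _ hbS
      have := hS _ hc
      congr 1
      clear h1 h2 h3 h4
      obtain ⟨b1, b2⟩ := b
      obtain ⟨c1, c2⟩ := c
      obtain ⟨x, y⟩ := v
      simp only at *
      rcases hbc with ⟨rfl, rfl⟩ | ⟨rfl, rfl⟩ | ⟨rfl, rfl⟩ | ⟨rfl, rfl⟩ | ⟨rfl, rfl⟩ | ⟨rfl, rfl⟩ <;>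
        split_ifs <;> first | (exfalso; omega) | rfl
    · intro M v hS hv
      have := hS _ hbS
      have := hS _ hc
      simp only [h4 M v hS hv, zero_add, ite_eq_right_iff]
      omega

/-- Two connections in an upper half plane with interlaced endpoints on its boundary meet. -/
theorem Conn.halfPlane_cross {S₁ S₂ : Set Site} {m a b c d : ℤ} (h₁ : Conn S₁ (a, m) (c, m))
    (h₂ : Conn S₂ (b, m) (d, m)) (hab : a < b) (hbc : b < c) (hcd : c < d)
    (hS₁ : ∀ s ∈ S₁, m ≤ s.2) (hS₂ : ∀ s ∈ S₂, m ≤ s.2) : ∃ v, v ∈ S₁ ∧ v ∈ S₂ := by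
  by_contra! hdis
  obtain ⟨F, hv, hh, hlow, -⟩ := h₁.exists_parity
  have hdis' : ∀ v ∈ S₂, v ∉ S₁ := fun v h2 h1 => hdis v h1 h2
  have hstep : ∀ x y y', (y' = y ∨ y' = y - 1) → (x, y) ∈ S₂ → (x + 1, y') ∈ S₂ →
      F (x, y) = F (x + 1, y') := by
    intro x y y' hy h1 h2
    have := hh x y y' hy (hdis' _ h1) (hdis' _ h2)
    have hy' := hS₂ _ h2
    simp only at hy'
    rw [if_neg (by simp only; omega), if_neg (by simp only; omega), add_zero] at this
    exact CharTwo.add_eq_zero.1 this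
  have hconst : F (d, m) = F (b, m) := by
    refine h₂.induct (P := fun v => F v = F (b, m)) rfl ?_
    rintro ⟨x, y⟩ ⟨x', y'⟩ hu ih huv hv'
    have hu := hu.mem_right
    rw [adj_iff] at huv
    simp only at huv
    rcases huv with ⟨rfl, rfl⟩ | ⟨h1, rfl⟩ | ⟨rfl, rfl⟩ | ⟨rfl, h1⟩ | ⟨rfl, rfl⟩ | ⟨h1, h2⟩
    · rw [← hstep _ _ _ (.inl rfl) hu hv', ih]
    · obtain rfl : x = x' + 1 := by omega
      rw [hstep _ _ _ (.inl rfl) hv' hu, ih]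
    · rw [← hv _ _ (hdis' _ hu) (hdis' _ hv'), ih]
    · obtain rfl : y = y' + 1 := by omega
      rw [hv _ _ (hdis' _ hv') (hdis' _ hu), ih]
    · rw [← hstep _ _ _ (.inr rfl) hu hv', ih]
    · obtain rfl : x = x' + 1 := by omega
      rw [hstep x' y' y (.inr (by omega)) hv' hu, ih]
  rw [hlow m _ hS₁ (hdis' _ h₂.mem_left) le_rfl, hlow m _ hS₁ (hdis' _ h₂.mem_right) le_rfl] at hconst
  simp only at hconst
  rw [if_pos (by omega), if_pos (by omega), if_pos (by omega), if_neg (by omega)] at hconst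
  exact absurd hconst (by decide)

/-- A left-right connection and a bottom-top connection of a rectangle meet. -/
theorem Conn.rect_cross {S₁ S₂ : Set Site} {x₀ x₁ y₀ y₁ : ℤ} {a b c d : Site}
    (h₁ : Conn S₁ a b) (h₂ : Conn S₂ c d) (ha : a.1 ≤ x₀) (hb : x₁ ≤ b.1) (hc : c.2 ≤ y₀)
    (hd : y₁ ≤ d.2) (hS₁ : ∀ s ∈ S₁, y₀ ≤ s.2 ∧ s.2 ≤ y₁)
    (hS₂ : ∀ s ∈ S₂, x₀ ≤ s.1 ∧ s.1 ≤ x₁) : ∃ v, v ∈ S₁ ∧ v ∈ S₂ := by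
  wlog hb' : x₁ < b.1 generalizing b S₁
  · have hbS := hS₁ _ h₁.mem_right
    have h₁' : Conn (S₁ ∪ {(b.1 + 1, b.2)}) a (b.1 + 1, b.2) :=
      (h₁.mono Set.subset_union_left).tail (by rw [adj_iff]; simp) (by simp)
    obtain ⟨v, hv | hv, hv'⟩ := this h₁' (by simp; omega)
      (by rintro s (hs | rfl); exacts [hS₁ s hs, hbS]) (by simp; omega)
    · exact ⟨v, hv, hv'⟩
    · obtain rfl := hv
      have := hS₂ _ hv'
      simp only at this
      omega
  by_contra! hdis
  obtain ⟨F, hv, hh, hlow, hhigh⟩ := h₁.exists_parity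
  have hdis' : ∀ v ∈ S₂, v ∉ S₁ := fun v h2 h1 => hdis v h1 h2
  have hstep : ∀ x y y', (y' = y ∨ y' = y - 1) → (x, y) ∈ S₂ → (x + 1, y') ∈ S₂ →
      F (x, y) = F (x + 1, y') := by
    intro x y y' hy h1 h2
    have := hh x y y' hy (hdis' _ h1) (hdis' _ h2)
    have hy' := hS₂ _ h2
    have hy := hS₂ _ h1
    simp only at hy' hy
    rw [if_neg (by omega), if_neg (by omega), add_zero] at this
    exact CharTwo.add_eq_zero.1 this
  have hconst : F d = F c := by
    refine h₂.induct (P := fun v => F v = F c) rfl ?_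
    rintro ⟨x, y⟩ ⟨x', y'⟩ hu ih huv hv'
    have hu := hu.mem_right
    rw [adj_iff] at huv
    simp only at huv
    rcases huv with ⟨rfl, rfl⟩ | ⟨h1, rfl⟩ | ⟨rfl, rfl⟩ | ⟨rfl, h1⟩ | ⟨rfl, rfl⟩ | ⟨h1, h2⟩
    · rw [← hstep _ _ _ (.inl rfl) hu hv', ih]
    · obtain rfl : x = x' + 1 := by omega
      rw [hstep _ _ _ (.inl rfl) hv' hu, ih]
    · rw [← hv _ _ (hdis' _ hu) (hdis' _ hv'), ih]
    · obtain rfl : y = y' + 1 := by omega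
      rw [hv _ _ (hdis' _ hv') (hdis' _ hu), ih]
    · rw [← hstep _ _ _ (.inr rfl) hu hv', ih]
    · obtain rfl : x = x' + 1 := by omega
      rw [hstep x' y' y (.inr (by omega)) hv' hu, ih]
  have hcS := hS₂ _ h₂.mem_left
  rw [hlow y₀ _ (fun s hs => (hS₁ s hs).1) (hdis' _ h₂.mem_left) hc,
    hhigh y₁ _ (fun s hs => (hS₁ s hs).2) hd, if_pos (by omega), if_neg (by omega)] at hconst
  exact absurd hconst (by decide)

theorem rainbow_parity : ∀ (i j k : Fin 3),
    (i = 1 → j = 2 → ¬k = 1 → k = 2) → (j = 1 → i = 2 → ¬k = 1 → k = 2) →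
    (i = 1 → k = 2 → ¬j = 1 → j = 2) → (k = 1 → i = 2 → ¬j = 1 → j = 2) →
    (j = 1 → k = 2 → ¬i = 1 → i = 2) → (k = 1 → j = 2 → ¬i = 1 → i = 2) →
    ((if i = 1 ∧ j = 2 ∨ i = 2 ∧ j = 1 then (1 : ZMod 2) else 0) +
      if j = 1 ∧ k = 2 ∨ j = 2 ∧ k = 1 then 1 else 0) =
        if i = 1 ∧ k = 2 ∨ i = 2 ∧ k = 1 then 1 else 0 := by
  intro i j k
  fin_cases i <;> fin_cases j <;> fin_cases k <;> simp <;> rfl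

/-- A Sperner lemma: if two disjoint sets meet the boundary of a rectangle in such a way that
there is exactly one boundary edge between them, then there is a triangle with one vertex in
each of the two sets and one vertex in neither. -/
theorem exists_rainbow_triangle {L₁ L₂ : Set Site} (hL : ∀ v ∈ L₁, v ∉ L₂) {x₀ x₁ y₀ y₁ k : ℤ}
    (hx : x₀ ≤ x₁) (hk₀ : y₀ < k) (hk₁ : k ≤ y₁)
    (hbot : ∀ x, x₀ ≤ x → x ≤ x₁ → (x, y₀) ∉ L₂) (htop : ∀ x, x₀ ≤ x → x ≤ x₁ → (x, y₁) ∉ L₁)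
    (hright : ∀ y, y₀ ≤ y → y ≤ y₁ → (x₁, y) ∉ L₁)
    (hleft₁ : ∀ y, y₀ ≤ y → y < k → (x₀, y) ∉ L₂) (hleft₂ : ∀ y, k ≤ y → y ≤ y₁ → (x₀, y) ∉ L₁)
    (hk₂ : (x₀, k - 1) ∈ L₁) (hk₃ : (x₀, k) ∈ L₂) :
    ∃ a b c, Adj a b ∧ Adj b c ∧ Adj a c ∧ a ∈ L₁ ∧ b ∈ L₂ ∧ c ∉ L₁ ∧ c ∉ L₂ ∧
      x₀ ≤ c.1 ∧ c.1 ≤ x₁ ∧ y₀ ≤ c.2 ∧ c.2 ≤ y₁ := by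
  classical
  by_contra hcon
  push Not at hcon
  set e : Site → Site → ZMod 2 := fun a b =>
    if (a ∈ L₁ ∧ b ∈ L₂) ∨ (a ∈ L₂ ∧ b ∈ L₁) then 1 else 0 with he
  have etri : ∀ a b c, Adj a b → Adj b c → Adj a c →
      (∀ v, v = a ∨ v = b ∨ v = c → x₀ ≤ v.1 ∧ v.1 ≤ x₁ ∧ y₀ ≤ v.2 ∧ v.2 ≤ y₁) →
      e a b + e b c = e a c := by
    intro a b c hab hbc hac hin
    have two : (1 : ZMod 2) + 1 = 0 := by decide
    have H : ∀ u v w, Adj u v → Adj v w → Adj u w → (w = a ∨ w = b ∨ w = c) →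
        u ∈ L₁ → v ∈ L₂ → w ∉ L₁ → w ∈ L₂ := by
      intro u v w h1 h2 h3 hw h4 h5 h6
      by_contra h7
      obtain ⟨i1, i2, i3, i4⟩ := hin w hw
      have := hcon u v w h1 h2 h3 h4 h5 h6 h7 i1 i2 i3
      omega
    have hlab : ∀ v, ∃ i : Fin 3, (v ∈ L₁ ↔ i = 1) ∧ (v ∈ L₂ ↔ i = 2) := by
      intro v
      by_cases h1 : v ∈ L₁
      · exact ⟨1, by simp [h1], by simp [hL v h1]⟩
      · by_cases h2 : v ∈ L₂
        · exact ⟨2, by simp [h1], by simp [h2]⟩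
        · exact ⟨0, by simp [h1], by simp [h2]⟩
    obtain ⟨i, hi1, hi2⟩ := hlab a
    obtain ⟨j, hj1, hj2⟩ := hlab b
    obtain ⟨k, hk1, hk2⟩ := hlab c
    have H1 := H a b c hab hbc hac (by simp)
    have H2 := H b a c hab.symm hac hbc (by simp)
    have H3 := H a c b hac hbc.symm hab (by simp)
    have H4 := H c a b hac.symm hab hbc.symm (by simp)
    have H5 := H b c a hbc hac.symm hab.symm (by simp)
    have H6 := H c b a hbc.symm hab.symm hac.symm (by simp)
    simp only [he, hi1, hi2, hj1, hj2, hk1, hk2] at H1 H2 H3 H4 H5 H6 ⊢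
    convert rainbow_parity i j k H1 H2 H3 H4 H5 H6
  have esymm : ∀ a b, e a b = e b a := by
    intro a b
    simp only [he]
    congr 1
    simp only [eq_iff_iff]
    tauto
  obtain ⟨N, hN⟩ := Int.le.dest hx
  set H : ℤ → ZMod 2 := fun y => ∑ i ∈ Finset.range N, e (x₀ + i, y) (x₀ + i + 1, y) with hH
  have hstrip : ∀ y, y₀ ≤ y → y + 1 ≤ y₁ →
      H y + H (y + 1) = e (x₀, y) (x₀, y + 1) + e (x₁, y) (x₁, y + 1) := by
    intro y hy hy'
    have gen : ∀ M : ℕ, M ≤ N → (∑ i ∈ Finset.range M, e (x₀ + i, y) (x₀ + i + 1, y)) +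
        ∑ i ∈ Finset.range M, e (x₀ + i, y + 1) (x₀ + i + 1, y + 1) =
        e (x₀, y) (x₀, y + 1) + e (x₀ + M, y) (x₀ + M, y + 1) := by
      intro M
      induction M with
      | zero => intro; simp [CharTwo.add_self_eq_zero]
      | succ M ih =>
        intro hM
        have ih := ih (by omega)
        rw [Finset.sum_range_succ, Finset.sum_range_succ, add_add_add_comm, ih]
        have t1 := etri (x₀ + M, y) (x₀ + M + 1, y) (x₀ + M, y + 1) (by rw [adj_iff]; simp)
          (by rw [adj_iff]; simp) (by rw [adj_iff]; simp)
          (by rintro v (rfl | rfl | rfl) <;> simp only <;> omega)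
        have t2 := etri (x₀ + M + 1, y) (x₀ + M, y + 1) (x₀ + M + 1, y + 1)
          (by rw [adj_iff]; simp)
          (by rw [adj_iff]; simp) (by rw [adj_iff]; simp)
          (by rintro v (rfl | rfl | rfl) <;> simp only <;> omega)
        push_cast
        rw [← add_assoc x₀, ← t1, ← t2]
        generalize e (x₀ + M, y) (x₀ + M + 1, y) = p
        generalize e (x₀ + M + 1, y) (x₀ + M, y + 1) = q
        generalize e (x₀ + M, y + 1) (x₀ + M + 1, y + 1) = r
        generalize e (x₀, y) (x₀, y + 1) = s
        clear * -
        revert p q r s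
        decide
    have := gen N le_rfl
    rw [hN] at this
    exact this
  have hval : ∀ y, y₀ ≤ y → y ≤ y₁ → H y = if y < k then 0 else 1 := by
    intro y hy
    induction y, hy using Int.leInduction with
    | base =>
      intro _
      rw [if_pos hk₀]
      refine Finset.sum_eq_zero fun i hi => ?_
      have := Finset.mem_range.1 hi
      have h1 := hbot (x₀ + i) (by omega) (by omega)
      have h2 := hbot (x₀ + i + 1) (by omega) (by omega)
      simp [he, h1, h2]
    | succ y hy ih =>
      intro hy1
      have ih := ih (by omega)
      have h1 := hstrip y hy hy1
      have h2 := hright y hy (by omega)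
      have h3 := hright (y + 1) (by omega) (by omega)
      have h4 : e (x₁, y) (x₁, y + 1) = 0 := by simp [he, h2, h3]
      rw [h4, add_zero, ih] at h1
      have h5 : H (y + 1) = (if y < k then 0 else 1) + e (x₀, y) (x₀, y + 1) := by
        rw [← h1, ← add_assoc, CharTwo.add_self_eq_zero, zero_add]
      rw [h5]
      rcases lt_trichotomy (y + 1) k with hlt | heq | hgt
      · have i1 := hleft₁ y hy (by omega)
        have i2 := hleft₁ (y + 1) (by omega) hlt
        rw [if_pos (by omega), if_pos (by omega)]
        simp [he, i1, i2]
      · rw [if_pos (by omega), if_neg (by omega)]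
        subst heq
        simp only [add_sub_cancel_right] at hk₂
        simp [he, hk₂, hk₃]
      · have i1 := hleft₂ y (by omega) (by omega)
        have i2 := hleft₂ (y + 1) (by omega) hy1
        rw [if_neg (by omega), if_neg (by omega)]
        simp [he, i1, i2]
  have h1 := hval y₁ (by omega) le_rfl
  rw [if_neg (by omega)] at h1
  have h0 : H y₁ = 0 := by
    refine Finset.sum_eq_zero fun i hi => ?_
    have := Finset.mem_range.1 hi
    have h1 := htop (x₀ + i) (by omega) (by omega)
    have h2 := htop (x₀ + i + 1) (by omega) (by omega)
    simp [he, h1, h2]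
  rw [h0] at h1
  exact absurd h1 (by decide)

/-! ### Lists and connections -/

theorem Adj.ne {a b : Site} (h : Adj a b) : a ≠ b := by
  rintro rfl
  rw [adj_iff] at h
  omega

theorem Conn.of_list {S : Set Site} {a b : Site} {p : List Site} (hp : p.IsChain Adj)
    (hS : ∀ v ∈ p, v ∈ S) (ha : p.head? = some a) (hb : p.getLast? = some b) : Conn S a b := by
  induction p generalizing a with
  | nil => simp at ha
  | cons x q ih =>
    obtain rfl : x = a := by simpa using ha
    cases q with
    | nil =>
      obtain rfl : x = b := by simpa using hb
      exact .refl (hS _ (by simp))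
    | cons y q =>
      have hp' := List.isChain_cons_cons.1 hp
      exact .head hp'.1 (hS _ (by simp)) (ih hp'.2 (fun v hv => hS v (by simp [hv])) rfl
        (by simpa using hb))

theorem Conn.exists_list {S : Set Site} {a b : Site} (h : Conn S a b) :
    ∃ p, PathIn S p ∧ p.head? = some a ∧ p.getLast? = some b := by
  classical
  let G : SimpleGraph Site :=
    { Adj := fun u v => Adj u v ∧ u ∈ S ∧ v ∈ S
      symm := ⟨fun u v h => ⟨h.1.symm, h.2.2, h.2.1⟩⟩
      loopless := ⟨fun u h => h.1.ne rfl⟩ }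
  have hr : G.Reachable a b := by
    refine h.induct (P := fun v => G.Reachable a v) (.refl _) fun u v hu ih huv hv => ?_
    exact ih.trans (SimpleGraph.Adj.reachable (G := G) ⟨huv, hu.mem_right, hv⟩)
  obtain ⟨w⟩ := hr
  have hS : ∀ (c d : Site) (w : G.Walk c d), c ∈ S → ∀ v ∈ w.support, v ∈ S := by
    intro c d w
    induction w with
    | nil => simp
    | cons e w ih =>
      intro hc v hv
      rcases List.mem_cons.1 (SimpleGraph.Walk.support_cons e w ▸ hv) with rfl | hv
      · exact hc
      · exact ih e.2.2 v hv
  refine ⟨w.toPath.1.support, ⟨⟨by simp, w.toPath.2.support_nodup, ?_⟩, hS _ _ _ h.mem_left⟩, ?_, ?_⟩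
  · refine w.toPath.1.isChain_adj_support.imp fun _ _ h => h.1
  · rw [List.head?_eq_some_head (by simp), SimpleGraph.Walk.head_support]
  · rw [List.getLast?_eq_some_getLast (by simp), SimpleGraph.Walk.getLast_support]

/-! ### Local events -/

/-- The event `E` depends only on the states of the sites of `Λ`. -/
def Loc (Λ : Set Site) (E : Set Config) : Prop :=
  ∀ ω ω' : Config, (∀ v ∈ Λ, ω v = ω' v) → ω ∈ E → ω' ∈ E

/-- The event `E` is increasing. -/
def Incr (E : Set Config) : Prop := ∀ ω ω' : Config, (∀ v, ω v = true → ω' v = true) → ω ∈ E → ω' ∈ E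

namespace Loc

variable {Λ Λ' : Set Site} {E F : Set Config}

theorem mono (h : Loc Λ E) (hΛ : Λ ⊆ Λ') : Loc Λ' E :=
  fun ω ω' hω => h ω ω' fun v hv => hω v (hΛ hv)

theorem inter (h : Loc Λ E) (h' : Loc Λ F) : Loc Λ (E ∩ F) :=
  fun ω ω' hω hE => ⟨h ω ω' hω hE.1, h' ω ω' hω hE.2⟩

theorem univ : Loc Λ Set.univ := fun _ _ _ _ => trivial

end Loc

theorem Incr.inter {E F : Set Config} (hE : Incr E) (hF : Incr F) : Incr (E ∩ F) :=
  fun ω ω' h hω => ⟨hE ω ω' h hω.1, hF ω ω' h hω.2⟩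

/-- Extension of a configuration on a finite set by closed sites. -/
def extendCfg {Λ : Finset Site} (η : Λ → Bool) : Config :=
  fun v => if h : v ∈ Λ then η ⟨v, h⟩ else false

theorem extendCfg_apply {Λ : Finset Site} (η : Λ → Bool) (v : Site) (h : v ∈ Λ) :
    extendCfg η v = η ⟨v, h⟩ := by simp [extendCfg, h]

/-- The cylinder event that the configuration agrees with `f` on `Λ`. -/
def cyl (Λ : Finset Site) (f : Config) : Set Config := {ω | ∀ v ∈ Λ, ω v = f v}

theorem measurableSet_cyl (Λ : Finset Site) (f : Config) : MeasurableSet (cyl Λ f) := by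
  have : cyl Λ f = ⋂ v ∈ Λ, (fun ω : Config => ω v) ⁻¹' {f v} := by
    ext ω; simp [cyl]
  rw [this]
  exact Finset.measurableSet_biInter _ fun v _ => measurable_pi_apply v (measurableSet_singleton _)

theorem Loc.eq_iUnion {Λ : Finset Site} {E : Set Config} (h : Loc Λ E) :
    E = ⋃ η ∈ {η : Λ → Bool | extendCfg η ∈ E}, cyl Λ (extendCfg η) := by
  ext ω
  simp only [Set.mem_iUnion, exists_prop]
  constructor
  · intro hω
    have : ∀ v ∈ (Λ : Set Site), ω v = extendCfg (fun v : Λ => ω v) v := fun v hv => by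
      rw [extendCfg_apply _ v hv]
    exact ⟨fun v => ω v, h _ _ this hω, this⟩
  · rintro ⟨η, hη, hω⟩
    exact h _ _ (fun v hv => (hω v hv).symm) hη

theorem Loc.measurableSet {Λ : Set Site} {E : Set Config} (h : Loc Λ E) (hΛ : Λ.Finite) :
    MeasurableSet E := by
  lift Λ to Finset Site using hΛ
  rw [h.eq_iUnion]
  exact MeasurableSet.biUnion (Set.toFinite _).countable fun _ _ => measurableSet_cyl _ _

theorem disjoint_cyl {Λ : Finset Site} {η η' : Λ → Bool} (h : η ≠ η') :
    Disjoint (cyl Λ (extendCfg η)) (cyl Λ (extendCfg η')) := by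
  rw [Set.disjoint_left]
  intro ω h1 h2
  apply h
  ext v
  rw [← extendCfg_apply η v v.2, ← extendCfg_apply η' v v.2, ← h1 v v.2, ← h2 v v.2]

theorem IsBernoulliHalf.cyl_eq {μ : Measure Config} (hμ : IsBernoulliHalf μ)
    (Λ : Finset Site) (f : Config) :
    μ.real (cyl Λ f) = (1 / 2) ^ Λ.card := by
  rw [measureReal_def, cyl, hμ.2]
  simp

open Classical in
theorem IsBernoulliHalf.sum_eq {μ : Measure Config} (hμ : IsBernoulliHalf μ)
    {Λ : Finset Site} {E F : Set Config} (hE : Loc Λ E)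
    (hF : MeasurableSet F) :
    μ.real (E ∩ F) = ∑ η : Λ → Bool, if extendCfg η ∈ E then μ.real (cyl Λ (extendCfg η) ∩ F)
      else 0 := by
  have := hμ.1
  rw [← Finset.sum_filter]
  conv_lhs => rw [hE.eq_iUnion, Set.iUnion₂_inter]
  rw [← measureReal_biUnion_finset]
  · congr 1
    ext ω
    simp
  · intro η _ η' _ hne
    exact (disjoint_cyl hne).mono Set.inter_subset_left Set.inter_subset_left
  · exact fun η _ => (measurableSet_cyl _ _).inter hF

open Classical in
theorem IsBernoulliHalf.real_eq {μ : Measure Config} (hμ : IsBernoulliHalf μ)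
    {Λ : Finset Site} {E : Set Config} (hE : Loc Λ E) :
    μ.real E = ∑ η : Λ → Bool, (1 / 2) ^ Λ.card * if extendCfg η ∈ E then (1 : ℝ) else 0 := by
  have := IsBernoulliHalf.sum_eq hμ hE MeasurableSet.univ
  simp only [Set.inter_univ, hμ.cyl_eq] at this
  simp only [this, mul_ite, mul_one, mul_zero]

theorem IsBernoulliHalf.eq_of_loc {μ : Measure Config} (hμ : IsBernoulliHalf μ)
    {ν : Measure Config} (hν : IsBernoulliHalf ν) {Λ : Set Site}
    (hΛ : Λ.Finite) {E : Set Config} (hE : Loc Λ E) : μ.real E = ν.real E := by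
  lift Λ to Finset Site using hΛ
  rw [hμ.real_eq hE, hν.real_eq hE]

/-- Harris' inequality for local increasing events. -/
theorem IsBernoulliHalf.harris {μ : Measure Config} (hμ : IsBernoulliHalf μ)
    {Λ : Set Site} (hΛ : Λ.Finite) {E F : Set Config}
    (hE : Loc Λ E) (hF : Loc Λ F) (iE : Incr E) (iF : Incr F) :
    μ.real E * μ.real F ≤ μ.real (E ∩ F) := by
  classical
  lift Λ to Finset Site using hΛ
  rw [hμ.real_eq hE, hμ.real_eq hF, hμ.real_eq (hE.inter hF)]
  have mono : ∀ {G : Set Config}, Incr G →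
      Monotone fun η : Λ → Bool => if extendCfg η ∈ G then (1 : ℝ) else 0 := by
    intro G hG η η' h
    simp only
    split_ifs with h1 h2
    · rfl
    · refine absurd (hG _ _ (fun v hv => ?_) h1) h2
      by_cases hvΛ : v ∈ Λ
      · rw [extendCfg_apply _ v hvΛ] at *
        exact le_antisymm le_top (hv ▸ h ⟨v, hvΛ⟩)
      · simp [extendCfg, hvΛ] at hv
    · exact zero_le_one
    · rfl
  have key := fkg (μ := fun _ : Λ → Bool => (1 / 2 : ℝ) ^ Λ.card)
    (f := fun η : Λ → Bool => if extendCfg η ∈ E then (1 : ℝ) else 0)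
    (g := fun η : Λ → Bool => if extendCfg η ∈ F then (1 : ℝ) else 0)
    (fun _ => by positivity) (fun _ => by dsimp; positivity) (fun _ => by dsimp; positivity)
    (mono iE) (mono iF) (fun _ _ => le_rfl)
  refine key.trans (le_of_eq ?_)
  have h1 : ∑ _η : Λ → Bool, (1 / 2 : ℝ) ^ Λ.card = 1 := by
    simp
  rw [h1, one_mul]
  refine Finset.sum_congr rfl fun η _ => ?_
  by_cases h1 : extendCfg η ∈ E <;> by_cases h2 : extendCfg η ∈ F <;> simp [h1, h2]

/-- Events depending on disjoint sets of sites are independent. -/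
theorem IsBernoulliHalf.indep {μ : Measure Config} (hμ : IsBernoulliHalf μ)
    {Λ Λ' : Set Site} (hΛ : Λ.Finite) (hΛ' : Λ'.Finite)
    (hd : Disjoint Λ Λ') {E F : Set Config} (hE : Loc Λ E) (hF : Loc Λ' F) :
    μ.real (E ∩ F) = μ.real E * μ.real F := by
  classical
  have hFm := hF.measurableSet hΛ'
  lift Λ to Finset Site using hΛ
  lift Λ' to Finset Site using hΛ'
  have hd' : Disjoint Λ Λ' := Finset.disjoint_coe.1 hd
  have key : ∀ η : Λ → Bool, μ.real (cyl Λ (extendCfg η) ∩ F) = (1 / 2) ^ Λ.card * μ.real F := by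
    intro η
    rw [Set.inter_comm, hμ.sum_eq hF (measurableSet_cyl _ _), hμ.real_eq hF, Finset.mul_sum]
    refine Finset.sum_congr rfl fun η' _ => ?_
    split_ifs with h
    · have : cyl Λ' (extendCfg η') ∩ cyl Λ (extendCfg η) =
          cyl (Λ ∪ Λ') fun v => if v ∈ Λ then extendCfg η v else extendCfg η' v := by
        ext ω
        simp only [cyl, Set.mem_inter_iff, Set.mem_ofPred_eq, Finset.mem_union]
        constructor
        · rintro ⟨h1, h2⟩ v hv
          split_ifs with h3
          · exact h2 v h3
          · exact h1 v (hv.resolve_left h3)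
        · intro h1
          refine ⟨fun v hv => ?_, fun v hv => ?_⟩
          · have := h1 v (.inr hv)
            rwa [if_neg fun h => Finset.disjoint_left.1 hd' h hv] at this
          · have := h1 v (.inl hv)
            rwa [if_pos hv] at this
      rw [this, hμ.cyl_eq, Finset.card_union_of_disjoint hd', pow_add, mul_one]
    · simp
  rw [hμ.sum_eq hE hFm, hμ.real_eq hE, Finset.sum_mul]
  refine Finset.sum_congr rfl fun η _ => ?_
  split_ifs
  · rw [key, mul_one]
  · simp

/-- The Bernoulli measure is invariant under bijections of the sites combined with a
permutation of the two states. -/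
theorem IsBernoulliHalf.invariant {μ : Measure Config} (hμ : IsBernoulliHalf μ)
    {Λ : Set Site} (hΛ : Λ.Finite) {E : Set Config}
    (hE : Loc Λ E) (σ : Equiv.Perm Site) (f : Equiv.Perm Bool) :
    μ.real {ω | (fun v => f (ω (σ v))) ∈ E} = μ.real E := by
  have := hμ.1
  have hm : Measurable fun (ω : Config) (v : Site) => f (ω (σ v)) :=
    measurable_pi_lambda _ fun v => (measurable_of_finite f).comp (measurable_pi_apply _)
  have hν : IsBernoulliHalf (μ.map fun (ω : Config) (v : Site) => f (ω (σ v))) := by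
    refine ⟨Measure.isProbabilityMeasure_map hm.aemeasurable, fun S g => ?_⟩
    rw [← cyl, Measure.map_apply hm (measurableSet_cyl S g)]
    have h2 := hμ.2 (S.map σ.toEmbedding) fun w => f.symm (g (σ.symm w))
    rw [Finset.card_map] at h2
    rw [← h2]
    congr 1
    ext ω
    simp only [cyl, Set.mem_preimage, Set.mem_ofPred_eq, Finset.mem_map_equiv]
    constructor
    · intro h v hv
      rw [← h _ hv]
      simp
    · intro h v hv
      rw [h (σ v) (by simpa using hv)]
      simp
  rw [hμ.eq_of_loc hν hΛ hE, measureReal_def, measureReal_def,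
    Measure.map_apply hm (hE.measurableSet hΛ)]
  rfl

/-- Conditioning on an explored set: inequalities between probabilities of events that
depend only on unexplored sites can be integrated over the exploration. -/
theorem IsBernoulliHalf.explore {μ : Measure Config} (hμ : IsBernoulliHalf μ)
    {Λ : Set Site} (hΛ : Λ.Finite) {T : Config → Set Site}
    {G : Set Config} {E F : Set Site → Set Config} {k : ℝ}
    (hTΛ : ∀ ω, T ω ⊆ Λ) (hT : ∀ ω ω', (∀ v ∈ T ω, ω v = ω' v) → T ω' = T ω)
    (hG : ∀ ω ω', (∀ v ∈ T ω, ω v = ω' v) → ω ∈ G → ω' ∈ G)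
    (hE : ∀ t, Loc (Λ \ t) (E t)) (hF : ∀ t, Loc (Λ \ t) (F t))
    (h : ∀ ω ∈ G, k * μ.real (E (T ω)) ≤ μ.real (F (T ω))) :
    k * μ.real (G ∩ {ω | ω ∈ E (T ω)}) ≤ μ.real (G ∩ {ω | ω ∈ F (T ω)}) := by
  classical
  have := hμ.1
  have hfin : (𝒫 Λ).Finite := hΛ.finite_subsets
  have hloc : ∀ t, Loc t (G ∩ {ω | T ω = t}) := by
    rintro t ω ω' hω ⟨h1, rfl⟩
    exact ⟨hG _ _ hω h1, hT _ _ hω⟩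
  have hdec : ∀ E : Set Site → Set Config, (∀ t, Loc (Λ \ t) (E t)) →
      μ.real (G ∩ {ω | ω ∈ E (T ω)}) =
        ∑ t ∈ hfin.toFinset, μ.real (G ∩ {ω | T ω = t}) * μ.real (E t) := by
    intro E hE
    have h1 : G ∩ {ω | ω ∈ E (T ω)} = ⋃ t ∈ hfin.toFinset, (G ∩ {ω | T ω = t}) ∩ E t := by
      ext ω
      simp only [Set.mem_inter_iff, Set.mem_ofPred_eq, Set.mem_iUnion, Set.Finite.mem_toFinset,
        Set.mem_powerset_iff, exists_prop]
      constructor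
      · rintro ⟨h1, h2⟩
        exact ⟨T ω, hTΛ ω, ⟨h1, rfl⟩, h2⟩
      · rintro ⟨t, -, ⟨h1, rfl⟩, h2⟩
        exact ⟨h1, h2⟩
    rw [h1, measureReal_biUnion_finset]
    · refine Finset.sum_congr rfl fun t ht => ?_
      have ht : t ⊆ Λ := by simpa using ht
      exact hμ.indep (hΛ.subset ht) (hΛ.subset Set.sdiff_subset) Set.disjoint_sdiff_right
        (hloc t) (hE t)
    · intro t _ t' _ hne
      rw [Function.onFun, Set.disjoint_left]
      rintro ω ⟨⟨-, rfl⟩, -⟩ ⟨⟨-, h2⟩, -⟩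
      exact hne h2
    · intro t ht
      have ht : t ⊆ Λ := by simpa using ht
      exact ((hloc t).measurableSet (hΛ.subset ht)).inter
        ((hE t).measurableSet (hΛ.subset Set.sdiff_subset))
  rw [hdec E hE, hdec F hF, Finset.mul_sum]
  refine Finset.sum_le_sum fun t _ => ?_
  by_cases hne : (G ∩ {ω | T ω = t}).Nonempty
  · obtain ⟨ω, h1, rfl⟩ := hne
    rw [mul_left_comm]
    exact mul_le_mul_of_nonneg_left (h ω h1) measureReal_nonneg
  · rw [Set.not_nonempty_iff_eq_empty.1 hne]
    simp

/-! ### Connection events -/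

theorem Conn.map {S S' : Set Site} {a b : Site} {σ : Site → Site} (h : Conn S a b)
    (hσ : ∀ u v, Adj u v → Adj (σ u) (σ v)) (hS : ∀ v ∈ S, σ v ∈ S') : Conn S' (σ a) (σ b) :=
  h.induct (P := fun v => Conn S' (σ a) (σ v)) (.refl (hS _ h.mem_left))
    fun u v _ ih huv hv => ih.tail (hσ u v huv) (hS v hv)

theorem Conn.avoid_or_last_exit {S X : Set Site} {a b : Site} (h : Conn S a b) (hb : b ∉ X) :
    Conn (S \ X) a b ∨ ∃ c d, c ∈ S ∧ c ∈ X ∧ Adj c d ∧ Conn (S \ X) d b := by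
  refine h.induct (P := fun v => v ∉ X → (Conn (S \ X) a v ∨
    ∃ c d, c ∈ S ∧ c ∈ X ∧ Adj c d ∧ Conn (S \ X) d v)) (fun ha => .inl (.refl ⟨h.1, ha⟩)) ?_ hb
  intro u v hu ih huv hv hvX
  by_cases huX : u ∈ X
  · exact .inr ⟨u, v, hu.mem_right, huX, huv, .refl ⟨hv, hvX⟩⟩
  · rcases ih huX with h1 | ⟨c, d, h1, h2, h3, h4⟩
    · exact .inl (h1.tail huv ⟨hv, hvX⟩)
    · exact .inr ⟨c, d, h1, h2, h3, h4.tail huv ⟨hv, hvX⟩⟩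

/-- The event that some site of `A` is connected to some site of `B` by a path of color `c`
inside `D`. -/
def Crossing (c : Bool) (D A B : Set Site) : Set Config :=
  {ω | ∃ a ∈ A, ∃ b ∈ B, Conn (D ∩ {v | ω v = c}) a b}

namespace Crossing

variable {c c' : Bool} {D D' A A' B B' : Set Site}

theorem loc : Loc D (Crossing c D A B) := by
  rintro ω ω' h ⟨a, ha, b, hb, hab⟩
  exact ⟨a, ha, b, hb, hab.mono fun v hv => ⟨hv.1, (h v hv.1).symm.trans hv.2⟩⟩

theorem incr : Incr (Crossing true D A B) := by
  rintro ω ω' h ⟨a, ha, b, hb, hab⟩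
  exact ⟨a, ha, b, hb, hab.mono fun v hv => ⟨hv.1, h v hv.2⟩⟩

theorem mono (hD : D ⊆ D') (hA : A ⊆ A') (hB : B ⊆ B') : Crossing c D A B ⊆ Crossing c D' A' B' := by
  rintro ω ⟨a, ha, b, hb, hab⟩
  exact ⟨a, hA ha, b, hB hb, hab.mono fun v hv => ⟨hD hv.1, hv.2⟩⟩

theorem real_le {μ : Measure Config} (hμ : IsBernoulliHalf μ) (hD' : D'.Finite) (c c' : Bool)
    (σ : Equiv.Perm Site) (hσ : ∀ u v, Adj u v → Adj (σ u) (σ v)) (h : ∀ v ∈ D, σ v ∈ D')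
    (hA : ∀ v ∈ D, v ∈ A → σ v ∈ A') (hB : ∀ v ∈ D, v ∈ B → σ v ∈ B') :
    μ.real (Crossing c D A B) ≤ μ.real (Crossing c' D' A' B') := by
  have := hμ.1
  rw [← hμ.invariant hD' loc σ.symm (Equiv.swap c c')]
  refine measureReal_mono ?_
  rintro ω ⟨a, ha, b, hb, hab⟩
  refine ⟨σ a, hA a hab.mem_left.1 ha, σ b, hB b hab.mem_right.1 hb, hab.map hσ fun v hv => ⟨h v hv.1, ?_⟩⟩
  have := hv.2
  simp only [Set.mem_ofPred_eq] at this ⊢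
  simp [this]

end Crossing

theorem Measure.real_harris_mul {μ : Measure Config} (hμ : IsBernoulliHalf μ) {Λ : Set Site}
    (hΛ : Λ.Finite) {E F : Set Config} (hE : Loc Λ E) (hF : Loc Λ F) (iE : Incr E) (iF : Incr F)
    {p q : ℝ} (hp : p ≤ μ.real E) (hq : q ≤ μ.real F) (hq0 : 0 ≤ q) :
    p * q ≤ μ.real (E ∩ F) :=
  (mul_le_mul hp hq hq0 measureReal_nonneg).trans (hμ.harris hΛ hE hF iE iF)

/-! ### Exploration of clusters -/

/-- The union of the clusters of color `c` in `D` of the sites of `N`. -/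
def clusterOf (c : Bool) (D N : Set Site) (ω : Config) : Set Site :=
  {v | ∃ a ∈ N, Conn (D ∩ {v | ω v = c}) a v}

/-- The sites whose states are revealed when the clusters of `N` are explored. -/
def explored (c : Bool) (D N : Set Site) (ω : Config) : Set Site :=
  N ∪ {v ∈ D | ∃ a ∈ clusterOf c D N ω, Adj a v}

section Explore

variable {c : Bool} {D N : Set Site} {ω ω' : Config}

theorem clusterOf_subset : clusterOf c D N ω ⊆ D ∩ {v | ω v = c} := by
  rintro v ⟨a, -, h⟩
  exact h.mem_right

theorem mem_clusterOf_of_mem_explored {v : Site} (h : v ∈ explored c D N ω) (hD : v ∈ D)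
    (hc : ω v = c) : v ∈ clusterOf c D N ω := by
  rcases h with h | ⟨-, a, ⟨b, hb, hba⟩, hav⟩
  · exact ⟨v, h, .refl ⟨hD, hc⟩⟩
  · exact ⟨b, hb, hba.tail hav ⟨hD, hc⟩⟩

theorem conn_clusterOf {v : Site} (h : v ∈ clusterOf c D N ω) :
    ∃ a ∈ N, Conn (clusterOf c D N ω) a v := by
  obtain ⟨a, ha, h⟩ := h
  exact ⟨a, ha, h.cluster.mono fun w hw => ⟨a, ha, hw⟩⟩

theorem clusterOf_subset_explored : clusterOf c D N ω ⊆ explored c D N ω := by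
  intro v hv
  obtain ⟨a, ha, h⟩ := conn_clusterOf hv
  refine h.induct (P := fun v => v ∈ explored c D N ω) (.inl ha) fun u w hu _ huw hw => ?_
  exact .inr ⟨(clusterOf_subset hw).1, u, hu.mem_right, huw⟩

theorem explored_subset (hN : N ⊆ D) : explored c D N ω ⊆ D :=
  Set.union_subset hN fun _ hv => hv.1

theorem conn_explored {v : Site} (h : v ∈ explored c D N ω) :
    ∃ a ∈ N, Conn (explored c D N ω) a v := by
  have h0 := h
  rcases h with h | ⟨hD, a, ha, hav⟩
  · exact ⟨v, h, .refl h0⟩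
  · obtain ⟨b, hb, hba⟩ := conn_clusterOf ha
    exact ⟨b, hb, (hba.mono clusterOf_subset_explored).tail hav h0⟩

theorem clusterOf_congr (h : ∀ v ∈ explored c D N ω, ω v = ω' v) :
    clusterOf c D N ω' = clusterOf c D N ω := by
  apply Set.Subset.antisymm
  · rintro v ⟨a, ha, hav⟩
    refine hav.induct (P := fun v => v ∈ clusterOf c D N ω) ?_ fun u w _ ih huw hw => ?_
    · exact ⟨a, ha, .refl ⟨hav.mem_left.1, (h a (.inl ha)).trans hav.mem_left.2⟩⟩
    · have hwe : w ∈ explored c D N ω := .inr ⟨hw.1, u, ih, huw⟩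
      exact mem_clusterOf_of_mem_explored hwe hw.1 ((h w hwe).trans hw.2)
  · intro v hv
    obtain ⟨a, ha, hav⟩ := conn_clusterOf hv
    refine ⟨a, ha, hav.mono fun w hw => ⟨(clusterOf_subset hw).1, ?_⟩⟩
    exact (h w (clusterOf_subset_explored hw)).symm.trans (clusterOf_subset hw).2

theorem explored_congr (h : ∀ v ∈ explored c D N ω, ω v = ω' v) :
    explored c D N ω' = explored c D N ω := by
  rw [explored, clusterOf_congr h, ← explored]

end Explore

/-! ### Duality -/

/-- The sites of `D` adjacent to `O`. -/
def nbhd (D O : Set Site) : Set Site := {v ∈ D | ∃ u ∈ O, Adj u v}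

/-- Duality: inside a rectangle, if the boundary is split into an arc `O₁` and an arc `O₂`
followed by a third arc, then the open cluster of `O₁` or the closed cluster of `O₂` reaches
the third arc in such a way that the two clusters and the arc come together. -/
theorem exists_triple_point {D O₁ O₂ : Set Site} (ω : Config) {x₀ x₁ y₀ y₁ k : ℤ} (hx : x₀ ≤ x₁)
    (hk₀ : y₀ < k) (hk₁ : k ≤ y₁) (hO : ∀ v ∈ O₁, v ∉ O₂) (hD₁ : ∀ v ∈ D, v ∉ O₁)
    (hD₂ : ∀ v ∈ D, v ∉ O₂) (hD : ∀ v ∈ D, x₀ < v.1 ∧ v.1 < x₁ ∧ y₀ < v.2 ∧ v.2 < y₁)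
    (hbot : ∀ x, x₀ ≤ x → x ≤ x₁ → (x, y₀) ∉ O₂) (htop : ∀ x, x₀ ≤ x → x ≤ x₁ → (x, y₁) ∉ O₁)
    (hright : ∀ y, y₀ ≤ y → y ≤ y₁ → (x₁, y) ∉ O₁)
    (hleft₁ : ∀ y, y₀ ≤ y → y < k → (x₀, y) ∉ O₂) (hleft₂ : ∀ y, k ≤ y → y ≤ y₁ → (x₀, y) ∉ O₁)
    (hk₂ : (x₀, k - 1) ∈ O₁) (hk₃ : (x₀, k) ∈ O₂) :
    ∃ a b c, Adj a b ∧ Adj b c ∧ Adj a c ∧ (a ∈ O₁ ∨ a ∈ clusterOf true D (nbhd D O₁) ω) ∧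
      (b ∈ O₂ ∨ b ∈ clusterOf false D (nbhd D O₂) ω) ∧ c ∉ O₁ ∧ c ∉ O₂ ∧ c ∉ D ∧
      x₀ ≤ c.1 ∧ c.1 ≤ x₁ ∧ y₀ ≤ c.2 ∧ c.2 ≤ y₁ := by
  have hC₁ := fun v (hv : v ∈ clusterOf true D (nbhd D O₁) ω) => hD v (clusterOf_subset hv).1
  have hC₂ := fun v (hv : v ∈ clusterOf false D (nbhd D O₂) ω) => hD v (clusterOf_subset hv).1
  obtain ⟨a, b, c, hab, hbc, hac, ha, hb, hc₁, hc₂, hc⟩ := exists_rainbow_triangle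
    (L₁ := O₁ ∪ clusterOf true D (nbhd D O₁) ω) (L₂ := O₂ ∪ clusterOf false D (nbhd D O₂) ω)
    (x₀ := x₀) (x₁ := x₁) (y₀ := y₀) (y₁ := y₁) (k := k)
    (by
      rintro v (h1 | h1) (h2 | h2)
      · exact hO v h1 h2
      · exact hD₁ v (clusterOf_subset h2).1 h1
      · exact hD₂ v (clusterOf_subset h1).1 h2
      · exact absurd ((clusterOf_subset h1).2.symm.trans (clusterOf_subset h2).2) (by simp))
    hx hk₀ hk₁
    (by rintro x h1 h2 (h | h); exacts [hbot x h1 h2 h, lt_irrefl _ (hC₂ _ h).2.2.1])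
    (by rintro x h1 h2 (h | h); exacts [htop x h1 h2 h, lt_irrefl _ (hC₁ _ h).2.2.2])
    (by rintro x h1 h2 (h | h); exacts [hright x h1 h2 h, lt_irrefl _ (hC₁ _ h).2.1])
    (by rintro x h1 h2 (h | h); exacts [hleft₁ x h1 h2 h, lt_irrefl _ (hC₂ _ h).1])
    (by rintro x h1 h2 (h | h); exacts [hleft₂ x h1 h2 h, lt_irrefl _ (hC₁ _ h).1])
    (.inl hk₂) (.inl hk₃)
  refine ⟨a, b, c, hab, hbc, hac, ha, hb, fun h => hc₁ (.inl h), fun h => hc₂ (.inl h), ?_, hc⟩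
  intro hcD
  cases hωc : ω c
  · apply hc₂
    rcases hb with hb | ⟨d, hd, hdb⟩
    · exact .inr ⟨c, ⟨hcD, b, hb, hbc⟩, .refl ⟨hcD, hωc⟩⟩
    · exact .inr ⟨d, hd, hdb.tail hbc ⟨hcD, hωc⟩⟩
  · apply hc₁
    rcases ha with ha | ⟨d, hd, hda⟩
    · exact .inr ⟨c, ⟨hcD, a, ha, hac⟩, .refl ⟨hcD, hωc⟩⟩
    · exact .inr ⟨d, hd, hda.tail hac ⟨hcD, hωc⟩⟩

theorem finite_box (x₀ x₁ y₀ y₁ : ℤ) {S : Set Site}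
    (h : ∀ v ∈ S, x₀ ≤ v.1 ∧ v.1 ≤ x₁ ∧ y₀ ≤ v.2 ∧ v.2 ≤ y₁) : S.Finite := by
  refine ((Set.finite_Icc x₀ x₁).prod (Set.finite_Icc y₀ y₁)).subset fun v hv => ?_
  obtain ⟨h1, h2, h3, h4⟩ := h v hv
  exact ⟨⟨h1, h2⟩, h3, h4⟩

/-! ### Crossings of long rectangles -/

/-- The exchange of the two coordinates, followed by a translation. -/
def swapShift (p q : ℤ) : Equiv.Perm Site where
  toFun v := (v.2 + p, v.1 + q)
  invFun v := (v.2 - q, v.1 - p)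
  left_inv v := by simp
  right_inv v := by simp

theorem swapShift_adj (p q : ℤ) (u v : Site) (h : Adj u v) :
    Adj (swapShift p q u) (swapShift p q v) := by
  rw [adj_iff] at *
  simp only [swapShift, Equiv.coe_fn_mk]
  omega

/-- A translation. -/
def shift (p q : ℤ) : Equiv.Perm Site where
  toFun v := (v.1 + p, v.2 + q)
  invFun v := (v.1 - p, v.2 - q)
  left_inv v := by simp
  right_inv v := by simp

theorem shift_adj (p q : ℤ) (u v : Site) (h : Adj u v) : Adj (shift p q u) (shift p q v) := by
  rw [adj_iff] at *
  simp only [shift, Equiv.coe_fn_mk]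
  omega

theorem half_le_rhombus {μ : Measure Config} (hμ : IsBernoulliHalf μ) {m : ℤ} (hm : 0 ≤ m) :
    1 / 2 ≤ μ.real (Crossing true {v | -m ≤ v.1 ∧ v.1 ≤ m ∧ 0 ≤ v.2 ∧ v.2 ≤ 2 * m}
      {v | v.1 ≤ -m} {v | m ≤ v.1}) := by
  have := hμ.1
  set D : Set Site := {v | -m ≤ v.1 ∧ v.1 ≤ m ∧ 0 ≤ v.2 ∧ v.2 ≤ 2 * m} with hD
  have hfin : D.Finite := finite_box (-m) m 0 (2 * m) fun v hv => hv
  have hcov : Crossing true D {v | v.1 ≤ -m} {v | m ≤ v.1} ∪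
      Crossing false D {v | 2 * m ≤ v.2} {v | v.2 ≤ 0} = Set.univ := by
    rw [Set.eq_univ_iff_forall]
    intro ω
    obtain ⟨a, b, c, hab, hbc, hac, ha, hb, hc₁, hc₂, hcD, hc⟩ := exists_triple_point (D := D)
      (O₁ := {v | v.1 = -m - 1 ∧ 0 ≤ v.2 ∧ v.2 ≤ 2 * m}) (O₂ := {v | v.2 = 2 * m + 1}) ω
      (x₀ := -m - 1) (x₁ := m + 1) (y₀ := -1) (y₁ := 2 * m + 1) (k := 2 * m + 1)
      (by omega) (by omega) (by omega)
      (by simp only [Set.mem_ofPred_eq]; intros; omega)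
      (by simp only [hD, Set.mem_ofPred_eq]; intros; omega)
      (by simp only [hD, Set.mem_ofPred_eq]; intros; omega)
      (by simp only [hD, Set.mem_ofPred_eq]; intros; omega)
      (by simp only [Set.mem_ofPred_eq]; intros; omega)
      (by simp only [Set.mem_ofPred_eq]; intros; omega)
      (by simp only [Set.mem_ofPred_eq]; intros; omega)
      (by simp only [Set.mem_ofPred_eq]; intros; omega)
      (by simp only [Set.mem_ofPred_eq]; intros; omega)
      (by simp only [Set.mem_ofPred_eq, true_and]; omega)
      (by simp only [Set.mem_ofPred_eq])
    rw [adj_iff] at hab hbc hac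
    simp only [Set.mem_ofPred_eq] at ha hb hc₁ hc₂
    by_cases hcm : c.1 = m + 1 ∧ -1 < c.2
    · left
      rcases ha with ha | ⟨a', ⟨-, a'', ha'', ha'⟩, haa⟩
      · omega
      · refine ⟨a', ?_, a, ?_, haa⟩
        · rw [adj_iff] at ha'
          simp only [Set.mem_ofPred_eq] at ha'' ⊢
          omega
        · simp only [Set.mem_ofPred_eq]
          omega
    · right
      have hcD' : ¬ (-m ≤ c.1 ∧ c.1 ≤ m ∧ 0 ≤ c.2 ∧ c.2 ≤ 2 * m) := hcD
      rcases ha with ha | ha <;> [skip; have haD := (clusterOf_subset ha).1] <;>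
      rcases hb with hb | ⟨b', ⟨-, b'', hb'', hb'⟩, hbb⟩
      · omega
      · refine ⟨b', ?_, b, ?_, hbb⟩
        · rw [adj_iff] at hb'
          simp only [Set.mem_ofPred_eq] at hb'' ⊢
          omega
        · have := hbb.mem_right.1
          simp only [hD, Set.mem_ofPred_eq] at this ⊢
          omega
      · simp only [hD, Set.mem_ofPred_eq] at haD
        omega
      · refine ⟨b', ?_, b, ?_, hbb⟩
        · rw [adj_iff] at hb'
          simp only [Set.mem_ofPred_eq] at hb'' ⊢
          omega
        · have := hbb.mem_right.1
          simp only [hD, Set.mem_ofPred_eq] at this haD ⊢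
          omega
  have hle : μ.real (Crossing false D {v | 2 * m ≤ v.2} {v | v.2 ≤ 0}) ≤
      μ.real (Crossing true D {v | m ≤ v.1} {v | v.1 ≤ -m}) := by
    refine Crossing.real_le hμ hfin _ _ (swapShift (-m) m) (swapShift_adj _ _) ?_ ?_ ?_ <;>
    · simp only [hD, Set.mem_ofPred_eq, swapShift, Equiv.coe_fn_mk]
      intros
      omega
  have hsymm : Crossing true D {v | m ≤ v.1} {v | v.1 ≤ -m} ⊆
      Crossing true D {v | v.1 ≤ -m} {v | m ≤ v.1} := by
    rintro ω ⟨a, ha, b, hb, hab⟩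
    exact ⟨b, hb, a, ha, hab.symm⟩
  have h1 := measureReal_union_le (μ := μ) (Crossing true D {v | v.1 ≤ -m} {v | m ≤ v.1})
    (Crossing false D {v | 2 * m ≤ v.2} {v | v.2 ≤ 0})
  rw [hcov, probReal_univ] at h1
  have h2 := hle.trans (measureReal_mono (μ := μ) hsymm)
  linarith

/-- A connection along a vertical segment followed by a horizontal one. -/
theorem Conn.ell {S : Set Site} {x y p q : ℤ}
    (hv : ∀ z, min y q ≤ z → z ≤ max y q → (x, z) ∈ S)
    (hh : ∀ z, min x p ≤ z → z ≤ max x p → (z, q) ∈ S) : Conn S (x, y) (p, q) := by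
  have h1 : Conn S (x, y) (x, q) := by
    rcases le_total y q with h | h
    · exact .vseg h fun z _ _ => hv z (by omega) (by omega)
    · exact (Conn.vseg h fun z _ _ => hv z (by omega) (by omega)).symm
  refine h1.trans ?_
  rcases le_total x p with h | h
  · exact .hseg h fun z _ _ => hh z (by omega) (by omega)
  · exact (Conn.hseg h fun z _ _ => hh z (by omega) (by omega)).symm

/-- The part of the strip `0 ≤ y ≤ h` between the lines `2x + y = 0` and `2x + y = L`. -/
def trapezoid (L h : ℤ) : Set Site :=
  {v | 0 ≤ v.2 ∧ v.2 ≤ h ∧ 0 ≤ 2 * v.1 + v.2 ∧ 2 * v.1 + v.2 ≤ L}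

theorem finite_trapezoid (L h : ℤ) : (trapezoid L h).Finite :=
  finite_box (-h) L 0 h fun v hv => by
    simp only [trapezoid, Set.mem_ofPred_eq] at hv
    omega

/-- The event that a trapezoid is crossed from left to right by an open path. -/
def LR (L h : ℤ) : Set Config :=
  Crossing true (trapezoid L h) {v | 2 * v.1 + v.2 ≤ 1} {v | L - 1 ≤ 2 * v.1 + v.2}

theorem Conn.truncate_trapezoid {S : Set Site} {a b : Site} {L : ℤ} (hL : 1 ≤ L) (h : Conn S a b)
    (ha : 2 * a.1 + a.2 ≤ 1) (hb : L - 1 ≤ 2 * b.1 + b.2) : ∃ a' b', 2 * a'.1 + a'.2 ≤ 1 ∧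
      L - 1 ≤ 2 * b'.1 + b'.2 ∧ Conn (S ∩ {v | 0 ≤ 2 * v.1 + v.2 ∧ 2 * v.1 + v.2 ≤ L}) a' b' := by
  obtain ⟨a', ha', h'⟩ : ∃ a', 2 * a'.1 + a'.2 ≤ 1 ∧ Conn (S \ {v | 2 * v.1 + v.2 < 0}) a' b := by
    rcases h.avoid_or_last_exit (X := {v | 2 * v.1 + v.2 < 0})
      (by simp only [Set.mem_ofPred_eq]; omega) with h | ⟨c, d, -, hc, hcd, hd⟩
    · exact ⟨a, ha, h⟩
    · refine ⟨d, ?_, hd⟩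
      rw [adj_iff] at hcd
      simp only [Set.mem_ofPred_eq] at hc
      omega
  obtain ⟨b', hb', h''⟩ : ∃ b', L - 1 ≤ 2 * b'.1 + b'.2 ∧
      Conn ((S \ {v | 2 * v.1 + v.2 < 0}) \ {v | L < 2 * v.1 + v.2}) b' a' := by
    rcases h'.symm.avoid_or_last_exit (X := {v | L < 2 * v.1 + v.2})
      (by simp only [Set.mem_ofPred_eq]; omega) with h | ⟨c, d, -, hc, hcd, hd⟩
    · exact ⟨b, hb, h⟩
    · refine ⟨d, ?_, hd⟩
      rw [adj_iff] at hcd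
      simp only [Set.mem_ofPred_eq] at hc
      omega
  exact ⟨a', b', ha', hb', h''.symm.mono fun v ⟨⟨h1, h2⟩, h3⟩ => ⟨h1, by simpa using h2, by simpa using h3⟩⟩

theorem half_le_LR {μ : Measure Config} (hμ : IsBernoulliHalf μ) {m : ℤ} (hm : 1 ≤ m) :
    1 / 2 ≤ μ.real (LR (2 * m) (2 * m)) := by
  have := hμ.1
  refine (half_le_rhombus hμ (by omega : 0 ≤ m)).trans (measureReal_mono ?_)
  rintro ω ⟨a, ha, b, hb, hab⟩
  have haD := hab.mem_left.1
  have hbD := hab.mem_right.1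
  simp only [Set.mem_ofPred_eq] at ha hb haD hbD
  obtain ⟨a', b', ha', hb', h⟩ := hab.truncate_trapezoid (L := 2 * m) (by omega) (by omega) (by omega)
  exact ⟨a', ha', b', hb', h.mono fun v ⟨⟨h1, h2⟩, h3⟩ => ⟨⟨h1.2.2.1, h1.2.2.2, h3⟩, h2⟩⟩

/-- The reflection in the line `2x + y = L`. -/
def mirror (L : ℤ) : Equiv.Perm Site where
  toFun v := (L - v.1 - v.2, v.2)
  invFun v := (L - v.1 - v.2, v.2)
  left_inv v := Prod.ext (by simp only; omega) rfl
  right_inv v := Prod.ext (by simp only; omega) rfl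

theorem mirror_apply (L : ℤ) (v : Site) : mirror L v = (L - v.1 - v.2, v.2) := rfl

theorem mirror_mirror (L : ℤ) (v : Site) : mirror L (mirror L v) = v := (mirror L).left_inv v

theorem mirror_adj (L : ℤ) (u v : Site) (h : Adj u v) : Adj (mirror L u) (mirror L v) := by
  rw [adj_iff] at *
  simp only [mirror_apply]
  omega

section Doubling

variable {L h : ℤ}

/-- The sites of the doubled trapezoid that are unaffected by the explored set `t` and by its
reflection. -/
def fresh (L h : ℤ) (t : Set Site) : Set Site :=
  {v ∈ trapezoid (2 * L) h | v ∉ t ∧ mirror L v ∉ t}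

theorem mirror_mem_fresh {t : Set Site} {v : Site} (hv : v ∈ fresh L h t) : mirror L v ∈ fresh L h t := by
  refine ⟨?_, hv.2.2, by rw [mirror_mirror]; exact hv.2.1⟩
  have := hv.1
  simp only [trapezoid, Set.mem_ofPred_eq, mirror_apply] at this ⊢
  omega

theorem lower_escape_le {μ : Measure Config} (hμ : IsBernoulliHalf μ) (hL : 2 ≤ L) (hh : 0 ≤ h)
    {t : Set Site} (htR : t ⊆ trapezoid (L - 1) h)
    (ht : ∀ w ∈ t, ∃ a ∈ t, a.2 = h ∧ Conn t a w) :
    2 * μ.real (Crossing false (fresh L h t) {v | ∃ w ∈ t, Adj v (mirror L w)}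
      {v | v.2 = 0 ∧ 2 * v.1 ≤ L}) ≤ 1 := by
  have := hμ.1
  have hfin : (fresh L h t).Finite := (finite_trapezoid (2 * L) h).subset fun v hv => hv.1
  have h1 : μ.real (Crossing false (fresh L h t) {v | ∃ w ∈ t, Adj v (mirror L w)}
      {v | v.2 = 0 ∧ 2 * v.1 ≤ L}) ≤ μ.real (Crossing true (fresh L h t) {v | ∃ w ∈ t, Adj v w}
      {v | v.2 = 0 ∧ L ≤ 2 * v.1}) := by
    refine Crossing.real_le hμ hfin _ _ (mirror L) (mirror_adj L) (fun v => mirror_mem_fresh) ?_ ?_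
    · rintro v - ⟨w, hw, hvw⟩
      exact ⟨w, hw, by simpa only [mirror_mirror] using mirror_adj L _ _ hvw⟩
    · simp only [Set.mem_ofPred_eq, mirror_apply]
      omega
  have h2 : Disjoint (Crossing false (fresh L h t) {v | ∃ w ∈ t, Adj v (mirror L w)}
      {v | v.2 = 0 ∧ 2 * v.1 ≤ L}) (Crossing true (fresh L h t) {v | ∃ w ∈ t, Adj v w}
      {v | v.2 = 0 ∧ L ≤ 2 * v.1}) := by
    rw [Set.disjoint_left]
    rintro ω ⟨p, ⟨w, hw, hpw⟩, ⟨q, q'⟩, ⟨hq, hqL⟩, hpq⟩ ⟨p₁, ⟨w₁, hw₁, hpw₁⟩, ⟨q₁, q₁'⟩, ⟨hq₁, hqL₁⟩, hpq₁⟩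
    simp only at hq hq₁ hqL hqL₁
    subst hq hq₁
    obtain ⟨a, hat, ha, haw⟩ := ht w hw
    obtain ⟨a₁, hat₁, ha₁, haw₁⟩ := ht w₁ hw₁
    have haR := htR hat
    have haR₁ := htR hat₁
    have hqD := hpq.mem_right.1.1
    have hqD₁ := hpq₁.mem_right.1.1
    simp only [trapezoid, Set.mem_ofPred_eq] at haR haR₁ hqD hqD₁
    rcases (show q ≤ q₁ by omega).eq_or_lt with rfl | hlt
    · exact absurd (hpq.mem_right.2.symm.trans hpq₁.mem_right.2) (by simp)
    obtain ⟨X, hX⟩ : ∃ X, X = 2 * L + 2 * h + 5 := ⟨_, rfl⟩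
    set S₁ : Set Site := (fresh L h t ∩ {v | ω v = true}) ∪ t ∪
      {v | v.2 = h + 1 ∧ 2 * v.1 + h ≤ L - 1} ∪ {v | v.1 = -X ∧ 0 ≤ v.2 ∧ v.2 ≤ h + 1} with hS₁
    set S₂ : Set Site := (fresh L h t ∩ {v | ω v = false}) ∪ {v | mirror L v ∈ t} ∪
      {v | v.2 = h + 1 ∧ L + 1 ≤ 2 * v.1 + h} ∪ {v | v.1 = X ∧ 0 ≤ v.2 ∧ v.2 ≤ h + 1} with hS₂
    have c₁ : Conn S₁ (-X, 0) (q₁, 0) := by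
      have e1 : Conn S₁ (-X, 0) (a₁.1, h + 1) := by
        refine Conn.ell (fun z _ _ => .inr ?_) fun z _ _ => .inl (.inr ?_)
        · simp only [Set.mem_ofPred_eq, true_and]
          omega
        · simp only [Set.mem_ofPred_eq, true_and]
          omega
      have e2 : Conn S₁ a₁ w₁ := haw₁.mono fun v hv => .inl (.inl (.inr hv))
      have e3 : Conn S₁ p₁ (q₁, 0) := hpq₁.mono fun v hv => .inl (.inl (.inl hv))
      exact (e1.tail (by rw [adj_iff]; simp only [true_and]; omega) e2.mem_left).trans
        ((e2.tail hpw₁.symm e3.mem_left).trans e3)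
    have c₂ : Conn S₂ (q, 0) (X, 0) := by
      have e1 : Conn S₂ (X, 0) ((mirror L a).1, h + 1) := by
        refine Conn.ell (fun z _ _ => .inr ?_) fun z _ _ => .inl (.inr ?_)
        · simp only [Set.mem_ofPred_eq, true_and]
          omega
        · simp only [Set.mem_ofPred_eq, true_and, mirror_apply] at *
          omega
      have e2 : Conn S₂ (mirror L a) (mirror L w) := haw.map (mirror_adj L) fun v hv => .inl (.inl (.inr (by
        simpa only [Set.mem_ofPred_eq, mirror_mirror] using hv)))
      have e3 : Conn S₂ p (q, 0) := hpq.mono fun v hv => .inl (.inl (.inl hv))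
      exact ((e1.tail (by rw [adj_iff]; simp only [mirror_apply, true_and]; omega) e2.mem_left).trans
        ((e2.tail hpw.symm e3.mem_left).trans e3)).symm
    obtain ⟨v, hv₁, hv₂⟩ := c₁.halfPlane_cross c₂ (by omega) hlt (by omega)
      (by
        rintro v (((hv | hv) | hv) | hv)
        · exact hv.1.1.1
        · exact (htR hv).1
        · simp only [Set.mem_ofPred_eq] at hv; omega
        · exact hv.2.1)
      (by
        rintro v (((hv | hv) | hv) | hv)
        · exact hv.1.1.1
        · exact (htR hv).1
        · simp only [Set.mem_ofPred_eq] at hv; omega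
        · exact hv.2.1)
    have k₁ : (v ∈ trapezoid (2 * L) h ∧ mirror L v ∉ t ∧ ω v = true) ∨
        (v ∈ trapezoid (L - 1) h ∧ v ∈ t) ∨ (v.2 = h + 1 ∧ 2 * v.1 + h ≤ L - 1) ∨ v.1 = -X := by
      rcases hv₁ with ((hv | hv) | hv) | hv
      exacts [.inl ⟨hv.1.1, hv.1.2.2, hv.2⟩, .inr (.inl ⟨htR hv, hv⟩), .inr (.inr (.inl hv)),
        .inr (.inr (.inr hv.1))]
    have k₂ : (v ∈ trapezoid (2 * L) h ∧ v ∉ t ∧ ω v = false) ∨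
        (mirror L v ∈ trapezoid (L - 1) h ∧ mirror L v ∈ t) ∨
        (v.2 = h + 1 ∧ L + 1 ≤ 2 * v.1 + h) ∨ v.1 = X := by
      rcases hv₂ with ((hv | hv) | hv) | hv
      exacts [.inl ⟨hv.1.1, hv.1.2.1, hv.2⟩, .inr (.inl ⟨htR hv, hv⟩), .inr (.inr (.inl hv)),
        .inr (.inr (.inr hv.1))]
    clear hv₁ hv₂
    rcases k₁ with ⟨k₁, k₁', k₁''⟩ | ⟨k₁, k₁'⟩ | k₁ | k₁ <;>
    rcases k₂ with ⟨k₂, k₂', k₂''⟩ | ⟨k₂, k₂'⟩ | k₂ | k₂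
    · exact absurd (k₁''.symm.trans k₂'') (by simp)
    · exact k₁' k₂'
    pick_goal 3
    · exact k₂' k₁'
    all_goals
      try simp only [trapezoid, Set.mem_ofPred_eq, mirror_apply] at k₁ k₂
      omega
  have h3 := measureReal_union (μ := μ) h2 (Crossing.loc.measurableSet hfin)
  have h4 : μ.real (Crossing false (fresh L h t) {v | ∃ w ∈ t, Adj v (mirror L w)}
      {v | v.2 = 0 ∧ 2 * v.1 ≤ L} ∪ Crossing true (fresh L h t) {v | ∃ w ∈ t, Adj v w}
      {v | v.2 = 0 ∧ L ≤ 2 * v.1}) ≤ 1 := measureReal_le_one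
  linarith

/-- The event that an open path of the doubled trapezoid joins its left side to its right side or
to the right half of its bottom side. -/
def rightEscape (L h : ℤ) : Set Config :=
  Crossing true (trapezoid (2 * L) h) {v | 2 * v.1 + v.2 ≤ 1}
    {v | 2 * L - 1 ≤ 2 * v.1 + v.2 ∨ v.2 = 0 ∧ L ≤ 2 * v.1}

theorem exists_closed_of_not_rightEscape (hL : 2 ≤ L) (hL2 : L % 2 = 0) (hh : 0 ≤ h) {ω : Config}
    (hω : ω ∉ rightEscape L h) :
    ω ∈ Crossing false (trapezoid (2 * L) h) {v | v.2 = h} {v | v.2 = 0 ∧ 2 * v.1 ≤ L} := by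
  obtain ⟨a, b, c, hab, hbc, hac, ha, hb, hc₁, hc₂, hcD, hc⟩ := exists_triple_point
    (D := trapezoid (2 * L) h) (O₁ := {v | 0 ≤ v.2 ∧ v.2 ≤ h ∧ 2 * v.1 + v.2 < 0})
    (O₂ := {v | v.2 = h + 1}) ω
    (x₀ := -h - 1) (x₁ := L + 1) (y₀ := -1) (y₁ := h + 1) (k := h + 1)
    (by omega) (by omega) (by omega)
    (by simp only [Set.mem_ofPred_eq]; intros; omega)
    (by simp only [trapezoid, Set.mem_ofPred_eq]; intros; omega)
    (by simp only [trapezoid, Set.mem_ofPred_eq]; intros; omega)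
    (by simp only [trapezoid, Set.mem_ofPred_eq]; intros; omega)
    (by simp only [Set.mem_ofPred_eq]; intros; omega)
    (by simp only [Set.mem_ofPred_eq]; intros; omega)
    (by simp only [Set.mem_ofPred_eq]; intros; omega)
    (by simp only [Set.mem_ofPred_eq]; intros; omega)
    (by simp only [Set.mem_ofPred_eq]; intros; omega)
    (by simp only [Set.mem_ofPred_eq]; omega)
    (by simp only [Set.mem_ofPred_eq])
  rw [adj_iff] at hab hbc hac
  have hA : a ∈ clusterOf true (trapezoid (2 * L) h) (nbhd (trapezoid (2 * L) h)
      {v | 0 ≤ v.2 ∧ v.2 ≤ h ∧ 2 * v.1 + v.2 < 0}) ω →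
      a ∈ trapezoid (2 * L) h ∧ ¬ (2 * L - 1 ≤ 2 * a.1 + a.2 ∨ a.2 = 0 ∧ L ≤ 2 * a.1) := by
    rintro ⟨a', ⟨-, a'', ha'', ha'⟩, haa⟩
    refine ⟨haa.mem_right.1, fun ha => hω ⟨a', ?_, a, ha, haa⟩⟩
    rw [adj_iff] at ha'
    simp only [Set.mem_ofPred_eq] at ha'' ⊢
    omega
  replace ha := ha.imp id hA
  simp only [trapezoid, Set.mem_ofPred_eq] at ha hb hc₁ hc₂ hcD
  rcases hb with hb | ⟨b', ⟨-, b'', hb'', hb'⟩, hbb⟩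
  · omega
  · refine ⟨b', ?_, b, ?_, hbb⟩
    · have := hbb.mem_left.1
      rw [adj_iff] at hb'
      simp only [Set.mem_ofPred_eq] at this hb'' ⊢
      omega
    · have := hbb.mem_right.1
      simp only [Set.mem_ofPred_eq] at this ⊢
      omega


theorem subset_fresh_escape (hL : 2 ≤ L) {ω : Config}
    (hω : ω ∈ Crossing false (trapezoid (2 * L) h) {v | v.2 = h} {v | v.2 = 0 ∧ 2 * v.1 ≤ L})
    (hG : ∀ v ∈ clusterOf false (trapezoid (L - 1) h) {v ∈ trapezoid (L - 1) h | v.2 = h} ω,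
      v.2 ≠ 0) :
    ω ∈ Crossing false (fresh L h (explored false (trapezoid (L - 1) h)
        {v ∈ trapezoid (L - 1) h | v.2 = h} ω))
      {v | ∃ w ∈ explored false (trapezoid (L - 1) h) {v ∈ trapezoid (L - 1) h | v.2 = h} ω,
        Adj v (mirror L w)} {v | v.2 = 0 ∧ 2 * v.1 ≤ L} := by
  obtain ⟨N, hN⟩ : ∃ N, N = {v ∈ trapezoid (L - 1) h | v.2 = h} := ⟨_, rfl⟩
  rw [← hN] at hG ⊢
  obtain ⟨t, ht⟩ : ∃ t, t = explored false (trapezoid (L - 1) h) N ω := ⟨_, rfl⟩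
  rw [← ht]
  have htR : t ⊆ trapezoid (L - 1) h := by
    rw [ht]
    exact explored_subset (by rw [hN]; exact fun v hv => hv.1)
  obtain ⟨a, ha, b, ⟨hb0, hbL⟩, hab⟩ := hω
  have hsub : ∀ v, v ∈ (trapezoid (2 * L) h ∩ {v | ω v = false}) \ {v | v ∈ t ∨ mirror L v ∈ t} →
      v ∈ fresh L h t ∩ {v | ω v = false} := by
    rintro v ⟨⟨h1, h2⟩, h3⟩
    simp only [Set.mem_ofPred_eq, not_or] at h3
    exact ⟨⟨h1, h3⟩, h2⟩
  rcases hab.avoid_or_last_exit (X := {v | v ∈ t ∨ mirror L v ∈ t}) (by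
    rintro (hb | hb)
    · have := htR hb
      rw [ht] at hb
      exact hG b (mem_clusterOf_of_mem_explored hb this hab.mem_right.2) hb0
    · have := htR hb
      simp only [trapezoid, Set.mem_ofPred_eq, mirror_apply] at this
      omega) with h1 | ⟨c, d, hc, hcX, hcd, hd⟩
  · refine ⟨a, ?_, b, ⟨hb0, hbL⟩, h1.mono hsub⟩
    have haD := hab.mem_left.1
    have hNt : ∀ v, v ∈ N → v ∈ t := fun v hv => by rw [ht]; exact .inl hv
    have h2 := h1.mem_left.2
    simp only [Set.mem_ofPred_eq, not_or] at h2 ha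
    have h3 : a ∉ N := fun h => h2.1 (hNt _ h)
    have h4 : mirror L a ∉ N := fun h => h2.2 (hNt _ h)
    simp only [hN, trapezoid, Set.mem_ofPred_eq, mirror_apply] at haD h3 h4
    refine ⟨(a.1 - 1, a.2), hNt _ ?_, ?_⟩
    · simp only [hN, trapezoid, Set.mem_ofPred_eq]
      omega
    · rw [adj_iff]
      simp only [mirror_apply, and_true]
      omega
  · refine ⟨d, ?_, b, ⟨hb0, hbL⟩, hd.mono hsub⟩
    rcases hcX with hcX | hcX
    · have hcR := htR hcX
      refine ⟨c, hcX, ?_⟩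
      have hdt : d ∉ t := fun h => hd.mem_left.2 (.inl h)
      have hdt' : mirror L d ∉ t := fun h => hd.mem_left.2 (.inr h)
      have hdR : d ∉ trapezoid (L - 1) h := by
        intro hdR
        rw [ht] at hcX hdt
        exact hdt (.inr ⟨hdR, c, mem_clusterOf_of_mem_explored hcX hcR hc.2, hcd⟩)
      have hdD := hd.mem_left.1.1
      by_cases hdL : 2 * d.1 + d.2 = L
      · have := mirror_adj L _ _ hcd
        rw [show mirror L d = d from Prod.ext (by simp only [mirror_apply]; omega) rfl] at this
        exact this.symm
      · exfalso
        apply hdt'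
        convert hcX using 1
        rw [adj_iff] at hcd
        simp only [trapezoid, Set.mem_ofPred_eq] at hdR hdD hcR
        exact Prod.ext (by simp only [mirror_apply]; omega) (by simp only [mirror_apply]; omega)
    · exact ⟨mirror L c, hcX, by rw [mirror_mirror]; exact hcd.symm⟩

theorem LR_forces {ω : Config} (hω : ω ∈ LR L h) :
    ∀ v ∈ clusterOf false (trapezoid (L - 1) h) {v ∈ trapezoid (L - 1) h | v.2 = h} ω,
      v.2 ≠ 0 := by
  intro d hd hd0
  obtain ⟨c, ⟨-, hc⟩, hcd⟩ := conn_clusterOf hd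
  obtain ⟨a, ha, b, hb, hab⟩ := hω
  simp only [Set.mem_ofPred_eq] at ha hb
  obtain ⟨S, hS⟩ : ∃ S : Set Site, S = (trapezoid L h ∩ {v | ω v = true}) ∪
    {v | 0 ≤ v.2 ∧ v.2 ≤ h ∧ (2 * v.1 + v.2 < 0 ∨ L - 1 < 2 * v.1 + v.2)} := ⟨_, rfl⟩
  have haD := hab.mem_left.1
  have hbD := hab.mem_right.1
  simp only [trapezoid, Set.mem_ofPred_eq] at haD hbD
  have e1 : Conn S (-h - 1, a.2) (a.1 - 1, a.2) := .hseg (by omega) fun z h1 h2 => by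
    rw [hS]
    right
    simp only [Set.mem_ofPred_eq]
    omega
  have e2 : Conn S a b := hab.mono (by rw [hS]; exact Set.subset_union_left)
  have e3 : Conn S (b.1 + 1, b.2) (L + 1, b.2) := .hseg (by omega) fun z h1 h2 => by
    rw [hS]
    right
    simp only [Set.mem_ofPred_eq]
    omega
  have h₁ := (e1.tail (by rw [adj_iff]; simp) e2.mem_left).trans
    ((e2.tail (by rw [adj_iff]; simp) e3.mem_left).trans e3)
  obtain ⟨v, hv, hv'⟩ := h₁.rect_cross (x₀ := -h - 1) (x₁ := L + 1) (y₀ := 0) (y₁ := h) hcd.symm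
    le_rfl le_rfl hd0.le hc.ge
    (by
      rw [hS]
      rintro s (hs | hs)
      exacts [⟨hs.1.1, hs.1.2.1⟩, ⟨hs.1, hs.2.1⟩])
    (by
      intro s hs
      have := (clusterOf_subset hs).1
      simp only [trapezoid, Set.mem_ofPred_eq] at this
      omega)
  have hvc := clusterOf_subset hv'
  rw [hS] at hv
  rcases hv with hv | hv
  · exact absurd (hv.2.symm.trans hvc.2) (by simp)
  · have := hvc.1
    simp only [trapezoid, Set.mem_ofPred_eq] at this hv
    omega

theorem half_LR_le_rightEscape {μ : Measure Config} (hμ : IsBernoulliHalf μ) (hL : 2 ≤ L)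
    (hL2 : L % 2 = 0) (hh : 0 ≤ h) : 1 / 2 * μ.real (LR L h) ≤ μ.real (rightEscape L h) := by
  have := hμ.1
  obtain ⟨N, hN⟩ : ∃ N, N = {v ∈ trapezoid (L - 1) h | v.2 = h} := ⟨_, rfl⟩
  have hNR : N ⊆ trapezoid (L - 1) h := by rw [hN]; exact fun v hv => hv.1
  have hsub : trapezoid (L - 1) h ⊆ trapezoid (2 * L) h := by
    intro v hv
    simp only [trapezoid, Set.mem_ofPred_eq] at hv ⊢
    omega
  have hfin := finite_trapezoid (2 * L) h
  set T : Config → Set Site := explored false (trapezoid (L - 1) h) N with hT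
  set G : Set Config := {ω | ∀ v ∈ clusterOf false (trapezoid (L - 1) h) N ω, v.2 ≠ 0} with hG
  have hLR : LR L h ⊆ G := fun ω hω => by
    rw [hG, hN]
    exact LR_forces hω
  have hGY : G \ rightEscape L h ⊆ G ∩ {ω | ω ∈ Crossing false (fresh L h (T ω))
      {v | ∃ w ∈ T ω, Adj v (mirror L w)} {v | v.2 = 0 ∧ 2 * v.1 ≤ L}} := by
    rintro ω ⟨hωG, hω⟩
    refine ⟨hωG, ?_⟩
    have := subset_fresh_escape hL (exists_closed_of_not_rightEscape hL hL2 hh hω)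
      (by rw [← hN]; exact hωG)
    rw [← hN] at this
    exact this
  have key := hμ.explore (Λ := trapezoid (2 * L) h) (T := T) (G := G) (k := 2)
    (E := fun t => Crossing false (fresh L h t) {v | ∃ w ∈ t, Adj v (mirror L w)}
      {v | v.2 = 0 ∧ 2 * v.1 ≤ L}) (F := fun _ => Set.univ) hfin
    (fun ω => (explored_subset hNR).trans hsub) (fun ω ω' => explored_congr)
    (fun ω ω' hω hG' => by
      simp only [hG, Set.mem_ofPred_eq] at hG' ⊢
      rwa [clusterOf_congr hω])
    (fun t => Crossing.loc.mono fun v hv => ⟨hv.1, hv.2.1⟩) (fun t => .univ)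
    (fun ω _ => by
      rw [probReal_univ]
      refine lower_escape_le hμ hL hh (explored_subset hNR) fun w hw => ?_
      obtain ⟨a, ha, haw⟩ := conn_explored hw
      refine ⟨a, .inl ha, ?_, haw⟩
      rw [hN] at ha
      exact ha.2)
  have h1 := measureReal_mono (μ := μ) hLR
  have h2 := measureReal_mono (μ := μ) hGY
  have h3 : μ.real (G ∩ {ω | ω ∈ (Set.univ : Set Config)}) ≤ μ.real G :=
    measureReal_mono Set.inter_subset_left
  have h4 : μ.real G ≤ μ.real (rightEscape L h) + μ.real (G \ rightEscape L h) :=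
    (measureReal_mono (by intro ω hω; by_cases h : ω ∈ rightEscape L h; exacts [.inl h, .inr ⟨hω, h⟩])).trans
      (measureReal_union_le _ _)
  linarith

theorem LR_double {μ : Measure Config} (hμ : IsBernoulliHalf μ) (hL : 2 ≤ L)
    (hL2 : L % 2 = 0) (hh : 0 ≤ h) : (1 / 2 * μ.real (LR L h)) ^ 2 ≤ μ.real (LR (2 * L) h) := by
  have := hμ.1
  have hfin := finite_trapezoid (2 * L) h
  have h1 := half_LR_le_rightEscape hμ hL hL2 hh
  set Y' : Set Config := Crossing true (trapezoid (2 * L) h) {v | 2 * L - 1 ≤ 2 * v.1 + v.2}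
    {v | 2 * v.1 + v.2 ≤ 1 ∨ v.2 = 0 ∧ 2 * v.1 ≤ L} with hY'
  have h2 : μ.real (rightEscape L h) ≤ μ.real Y' := by
    refine Crossing.real_le hμ hfin _ _ (mirror L) (mirror_adj L) ?_ ?_ ?_ <;>
    · simp only [trapezoid, Set.mem_ofPred_eq, mirror_apply]
      intros
      omega
  have h3 := Measure.real_harris_mul hμ hfin Crossing.loc Crossing.loc Crossing.incr Crossing.incr
    h1 (h1.trans h2) (by positivity)
  rw [sq]
  refine h3.trans (measureReal_mono ?_)
  rintro ω ⟨⟨a, ha, b, hb, hab⟩, a', ha', b', hb', hab'⟩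
  have haD := hab.mem_left.1
  have haD' := hab'.mem_left.1
  simp only [trapezoid, Set.mem_ofPred_eq] at ha hb ha' hb' haD haD'
  rcases hb with hb | ⟨hb0, hbL⟩
  · exact ⟨a, ha, b, hb, hab⟩
  rcases hb' with hb' | ⟨hb0', hbL'⟩
  · exact ⟨b', hb', a', ha', hab'.symm⟩
  refine ⟨a, ha, a', ha', ?_⟩
  obtain ⟨O, hO⟩ : ∃ O, O = trapezoid (2 * L) h ∩ {v | ω v = true} := ⟨_, rfl⟩
  rw [← hO] at hab hab' ⊢
  suffices ∃ v, Conn O a v ∧ Conn O a' v by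
    obtain ⟨v, hv, hv'⟩ := this
    exact hv.trans hv'.symm
  by_contra! hne
  have hOD : ∀ v ∈ O, 0 ≤ v.2 ∧ v.2 ≤ h ∧ 0 ≤ 2 * v.1 + v.2 ∧ 2 * v.1 + v.2 ≤ 2 * L := by
    intro v hv
    rw [hO] at hv
    exact hv.1
  have hbO := hOD _ hab.mem_right
  have hbO' := hOD _ hab'.mem_right
  have hlt : b'.1 < b.1 := by
    rcases (show b'.1 ≤ b.1 by omega).eq_or_lt with he | hlt
    · rw [show b' = b from Prod.ext he (hb0'.trans hb0.symm)] at hab'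
      exact absurd hab' (hne b hab)
    · exact hlt
  obtain ⟨X, hX⟩ : ∃ X, X = 2 * L + 2 * h + 5 := ⟨_, rfl⟩
  obtain ⟨S₁, hS₁⟩ : ∃ S₁ : Set Site, S₁ = {v | Conn O a v} ∪
    {v | 0 ≤ v.2 ∧ 2 * v.1 + v.2 < 0} := ⟨_, rfl⟩
  obtain ⟨S₂, hS₂⟩ : ∃ S₂ : Set Site, S₂ = {v | Conn O a' v} ∪
    {v | 0 ≤ v.2 ∧ 2 * L < 2 * v.1 + v.2} := ⟨_, rfl⟩
  have c₁ : Conn S₁ (-X, 0) (b.1, 0) := by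
    have e1 : Conn S₁ (-X, 0) (a.1 - 1, a.2) := by
      refine Conn.ell (fun z _ _ => ?_) fun z _ _ => ?_ <;>
      · rw [hS₁]
        right
        simp only [Set.mem_ofPred_eq]
        omega
    have e2 : Conn S₁ a b := hab.cluster.mono (by rw [hS₁]; exact Set.subset_union_left)
    rw [show b = (b.1, 0) from Prod.ext rfl hb0] at e2
    exact (e1.tail (by rw [adj_iff]; simp) e2.mem_left).trans e2
  have c₂ : Conn S₂ (b'.1, 0) (X, 0) := by
    have e1 : Conn S₂ (X, 0) (a'.1 + 1, a'.2) := by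
      refine Conn.ell (fun z _ _ => ?_) fun z _ _ => ?_ <;>
      · rw [hS₂]
        right
        simp only [Set.mem_ofPred_eq]
        omega
    have e2 : Conn S₂ a' b' := hab'.cluster.mono (by rw [hS₂]; exact Set.subset_union_left)
    rw [show b' = (b'.1, 0) from Prod.ext rfl hb0'] at e2
    exact ((e1.tail (by rw [adj_iff]; simp) e2.mem_left).trans e2).symm
  obtain ⟨v, hv₁, hv₂⟩ := c₁.halfPlane_cross c₂ (by omega) hlt (by omega)
    (by
      rw [hS₁]
      rintro v (hv | hv)
      exacts [(hOD v hv.mem_right).1, hv.1])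
    (by
      rw [hS₂]
      rintro v (hv | hv)
      exacts [(hOD v hv.mem_right).1, hv.1])
  rw [hS₁] at hv₁
  rw [hS₂] at hv₂
  rcases hv₁ with hv₁ | hv₁ <;> rcases hv₂ with hv₂ | hv₂
  · exact hne v hv₁ hv₂
  · have := hOD v hv₁.mem_right
    have := hv₂.2
    omega
  · have := hOD v hv₂.mem_right
    have := hv₁.2
    omega
  · have := hv₂.2
    have := hv₁.2
    omega

end Doubling

theorem LR_ge (k : ℕ) : ∃ c : ℝ, 0 < c ∧ ∀ μ : Measure Config, IsBernoulliHalf μ → ∀ m : ℤ, 1 ≤ m →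
    c ≤ μ.real (LR (2 ^ k * (2 * m)) (2 * m)) := by
  induction k with
  | zero => exact ⟨1 / 2, by norm_num, fun μ hμ m hm => by simpa using half_le_LR hμ hm⟩
  | succ k ih =>
    obtain ⟨c, hc, ih⟩ := ih
    refine ⟨(1 / 2 * c) ^ 2, by positivity, fun μ hμ m hm => ?_⟩
    have hk : (1 : ℤ) ≤ 2 ^ k := one_le_pow₀ (by norm_num)
    have h2 : (2 : ℤ) ^ k * (2 * m) = 2 * (2 ^ k * m) := by ring
    have h1 := LR_double hμ (L := 2 ^ k * (2 * m)) (h := 2 * m)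
      (by rw [h2]; nlinarith) (by rw [h2]; omega) (by omega)
    rw [show (2 : ℤ) ^ (k + 1) * (2 * m) = 2 * (2 ^ k * (2 * m)) by ring]
    refine le_trans ?_ h1
    have := ih μ hμ m hm
    gcongr

theorem mem_rect {x₀ x₁ y₀ y₁ : ℤ} {v : Site} :
    v ∈ rect x₀ x₁ y₀ y₁ ↔ x₀ ≤ v.1 ∧ v.1 ≤ x₁ ∧ y₀ ≤ v.2 ∧ v.2 ≤ y₁ := Iff.rfl

theorem rect_crossing : ∃ c : ℝ, 0 < c ∧ ∀ μ : Measure Config, IsBernoulliHalf μ →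
    ∀ s x₀ x₁ y₀ y₁ : ℤ, 2 ≤ s → x₀ ≤ x₁ → x₁ - x₀ ≤ 64 * s → s ≤ y₁ - y₀ →
    c ≤ μ.real (Crossing true (rect x₀ x₁ y₀ y₁) {v | v.1 = x₀} {v | v.1 = x₁}) ∧
    c ≤ μ.real (Crossing true (rect y₀ y₁ x₀ x₁) {v | v.2 = x₀} {v | v.2 = x₁}) := by
  obtain ⟨c, hc, h⟩ := LR_ge 8
  refine ⟨c, hc, fun μ hμ s x₀ x₁ y₀ y₁ hs hx hxs hys => ?_⟩
  have := hμ.1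
  have h1 : c ≤ μ.real (Crossing true (rect x₀ x₁ y₀ y₁) {v | v.1 = x₀} {v | v.1 = x₁}) := by
    obtain ⟨m, hm⟩ : ∃ m, m = s / 2 := ⟨_, rfl⟩
    obtain ⟨L, hL⟩ : ∃ L, L = 2 ^ 8 * (2 * m) := ⟨_, rfl⟩
    have hc := h μ hμ m (by omega)
    rw [← hL] at hc
    have hfin : {v : Site | y₀ ≤ v.2 ∧ v.2 ≤ y₁ ∧ x₀ - 2 * m ≤ v.1 ∧ v.1 ≤ x₀ + L}.Finite :=
      finite_box (x₀ - 2 * m) (x₀ + L) y₀ y₁ fun v hv => ⟨hv.2.2.1, hv.2.2.2, hv.1, hv.2.1⟩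
    have h2 : μ.real (LR L (2 * m)) ≤ μ.real (Crossing true
        {v : Site | y₀ ≤ v.2 ∧ v.2 ≤ y₁ ∧ x₀ - 2 * m ≤ v.1 ∧ v.1 ≤ x₀ + L}
        {v | v.1 ≤ x₀} {v | x₁ ≤ v.1}) := by
      refine Crossing.real_le hμ hfin _ _ (shift x₀ y₀) (shift_adj x₀ y₀) ?_ ?_ ?_ <;>
      · simp only [trapezoid, Set.mem_ofPred_eq, shift, Equiv.coe_fn_mk]
        intros
        omega
    refine hc.trans (h2.trans (measureReal_mono ?_))
    rintro ω ⟨a, ha, b, hb, hab⟩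
    obtain ⟨a', b', ha', hb', h'⟩ := hab.truncate (f := fun v => v.1)
      (fun u v huv => by rw [adj_iff] at huv; omega) hx ha hb
    exact ⟨a', ha', b', hb', h'.mono fun v hv => ⟨⟨hv.2.1, hv.2.2, hv.1.1.1, hv.1.1.2.1⟩, hv.1.2⟩⟩
  refine ⟨h1, h1.trans ?_⟩
  refine Crossing.real_le hμ (finite_box y₀ y₁ x₀ x₁ (S := rect y₀ y₁ x₀ x₁) fun v hv => hv) _ _ (swapShift 0 0)
    (swapShift_adj 0 0) ?_ ?_ ?_
  · simp only [mem_rect, swapShift, Equiv.coe_fn_mk]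
    intros
    omega
  all_goals simp [swapShift]

/-- The part of the upper half plane between the boxes of radii `p` and `q`. -/
def ring (p q : ℤ) : Set Site :=
  {v | 0 ≤ v.2 ∧ v.2 ≤ q ∧ -q ≤ v.1 ∧ v.1 ≤ q ∧ (v.1 ≤ -p ∨ p ≤ v.1 ∨ p ≤ v.2)}

theorem finite_ring (p q : ℤ) : (ring p q).Finite :=
  finite_box (-q) q 0 q fun _ hv => ⟨hv.2.2.1, hv.2.2.2.1, hv.1, hv.2.1⟩

/-- The event that the two ends of a half ring are joined inside it by a path of color `c`. -/
def Arc (c : Bool) (p q : ℤ) : Set Config :=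
  Crossing c (ring p q) {v | v.1 < 0 ∧ v.2 = 0} {v | 0 < v.1 ∧ v.2 = 0}

theorem arc_ge : ∃ c : ℝ, 0 < c ∧ ∀ μ : Measure Config, IsBernoulliHalf μ → ∀ s : ℤ, 2 ≤ s →
    ∀ b, c ≤ μ.real (Arc b (2 * s) (3 * s)) := by
  obtain ⟨c, hc, h⟩ := rect_crossing
  refine ⟨c * (c * c), by positivity, fun μ hμ s hs b => ?_⟩
  have := hμ.1
  have h1 := (h μ hμ s 0 (3 * s) (-(3 * s)) (-(2 * s)) hs (by omega) (by omega) (by omega)).2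
  have h2 := (h μ hμ s (-(3 * s)) (3 * s) (2 * s) (3 * s) hs (by omega) (by omega) (by omega)).1
  have h3 := (h μ hμ s 0 (3 * s) (2 * s) (3 * s) hs (by omega) (by omega) (by omega)).2
  have hfin : (rect (-(3 * s)) (3 * s) 0 (3 * s)).Finite := finite_box _ _ _ _ fun v hv => hv
  have l1 : rect (-(3 * s)) (-(2 * s)) 0 (3 * s) ⊆ rect (-(3 * s)) (3 * s) 0 (3 * s) := by
    intro v hv; simp only [rect, Set.mem_ofPred_eq] at *; omega
  have l2 : rect (-(3 * s)) (3 * s) (2 * s) (3 * s) ⊆ rect (-(3 * s)) (3 * s) 0 (3 * s) := by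
    intro v hv; simp only [rect, Set.mem_ofPred_eq] at *; omega
  have l3 : rect (2 * s) (3 * s) 0 (3 * s) ⊆ rect (-(3 * s)) (3 * s) 0 (3 * s) := by
    intro v hv; simp only [rect, Set.mem_ofPred_eq] at *; omega
  have h23 := Measure.real_harris_mul hμ hfin (Crossing.loc.mono l2) (Crossing.loc.mono l3)
    Crossing.incr Crossing.incr h2 h3 hc.le
  have h123 := Measure.real_harris_mul hμ hfin (Crossing.loc.mono l1)
    ((Crossing.loc.mono l2).inter (Crossing.loc.mono l3)) Crossing.incr
    (Crossing.incr.inter Crossing.incr) h1 h23 (by positivity)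
  have hflip : μ.real (Arc true (2 * s) (3 * s)) ≤ μ.real (Arc b (2 * s) (3 * s)) :=
    Crossing.real_le hμ (finite_ring _ _) _ _ (Equiv.refl _) (fun _ _ h => h) (fun _ h => h)
      (fun _ _ h => h) (fun _ _ h => h)
  refine (h123.trans (measureReal_mono ?_)).trans hflip
  rintro ω ⟨⟨a₁, ha₁, b₁, hb₁, h₁⟩, ⟨a₂, ha₂, b₂, hb₂, h₂⟩, ⟨a₃, ha₃, b₃, hb₃, h₃⟩⟩
  simp only [Set.mem_ofPred_eq] at ha₁ ha₂ ha₃ hb₁ hb₂ hb₃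
  have hA := h₁.mem_left.1
  have hB := h₃.mem_left.1
  simp only [rect, Set.mem_ofPred_eq] at hA hB
  obtain ⟨v, hv2, hv1⟩ := h₂.cluster.rect_cross (x₀ := -(3 * s)) (x₁ := -(2 * s)) (y₀ := 2 * s)
    (y₁ := 3 * s) h₁.cluster ha₂.le (by omega) (by omega) hb₁.ge
    (fun v hv => hv.mem_right.1.2.2) (fun v hv => ⟨hv.mem_right.1.1, hv.mem_right.1.2.1⟩)
  obtain ⟨w, hw2, hw3⟩ := h₂.cluster.rect_cross (x₀ := 2 * s) (x₁ := 3 * s) (y₀ := 2 * s)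
    (y₁ := 3 * s) h₃.cluster (by omega) hb₂.ge (by omega) hb₃.ge
    (fun v hv => hv.mem_right.1.2.2) (fun v hv => ⟨hv.mem_right.1.1, hv.mem_right.1.2.1⟩)
  have r1 : rect (-(3 * s)) (-(2 * s)) 0 (3 * s) ⊆ ring (2 * s) (3 * s) := by
    intro v hv; simp only [rect, ring, Set.mem_ofPred_eq] at *; omega
  have r2 : rect (-(3 * s)) (3 * s) (2 * s) (3 * s) ⊆ ring (2 * s) (3 * s) := by
    intro v hv; simp only [rect, ring, Set.mem_ofPred_eq] at *; omega
  have r3 : rect (2 * s) (3 * s) 0 (3 * s) ⊆ ring (2 * s) (3 * s) := by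
    intro v hv; simp only [rect, ring, Set.mem_ofPred_eq] at *; omega
  refine ⟨a₁, ⟨by omega, ha₁⟩, a₃, ⟨by omega, ha₃⟩, ?_⟩
  have e1 := hv1.mono (Set.inter_subset_inter_left {v | ω v = true} r1)
  have e2 := hv2.mono (Set.inter_subset_inter_left {v | ω v = true} r2)
  have e3 := hw2.mono (Set.inter_subset_inter_left {v | ω v = true} r2)
  have e4 := hw3.mono (Set.inter_subset_inter_left {v | ω v = true} r3)
  exact ((e1.trans e2.symm).trans e3).trans e4.symm

/-! ### Separation in the slit half plane -/

/-- A set attached to the site `(l, 0)` through the lower part of the right side of the inner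
box, and containing the positive axis. -/
structure Attached (l n : ℤ) (t : Set Site) : Prop where
  sub : ∀ v ∈ t, 0 ≤ v.1 ∧ v.1 ≤ n ∧ 0 ≤ v.2 ∧ v.2 ≤ n ∧ (l < v.1 ∨ l < v.2)
  conn : ∀ v ∈ t, Conn (t ∪ {v | v.1 = l ∧ 0 ≤ v.2 ∧ 8 * v.2 < 3 * l}) v (l, 0)
  axis : ∀ x, l < x → x ≤ n → (x, 0) ∈ t

/-- The sites at distance at most one of `K₂`. -/
def nearK2 (l : ℤ) : Set Site := {v | v ∈ K2 l ∨ ∃ u ∈ K2 l, Adj u v}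

section Separation

variable {l n ρ ρ' c : ℤ} {t S₁ S₂ : Set Site} {s v z b : Site}

theorem Attached.separate (ht : Attached l n t) (h₂ : Conn S₂ (-ρ, 0) v) (hvz : Adj v z)
    (hz : z ∈ t) (h₁ : Conn S₁ (-ρ', 0) (c, 0)) (hρ : ρ < ρ') (hc : -ρ < c) (hcl : c < l)
    (hS₂ : ∀ v ∈ S₂, 0 ≤ v.2)
    (hS₁ : ∀ v ∈ S₁, 0 ≤ v.2 ∧ v ∉ t ∧ ¬ (v.1 = l ∧ 8 * v.2 < 3 * l)) : ∃ v ∈ S₁, v ∈ S₂ := by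
  have h := (h₂.mono (Set.subset_union_left (t := t ∪ {v | v.1 = l ∧ 0 ≤ v.2 ∧ 8 * v.2 < 3 * l})))
  have h' := (ht.conn z hz).mono (Set.subset_union_right (s := S₂))
  obtain ⟨v, hv₁, hv₂ | hv₂ | hv₂⟩ := h₁.halfPlane_cross ((h.tail hvz h'.mem_left).trans h')
    (by omega) hc hcl (fun v hv => (hS₁ v hv).1)
    (by
      rintro v (hv | hv | hv)
      exacts [hS₂ v hv, (ht.sub v hv).2.2.1, hv.2.1])
  · exact ⟨v, hv₁, hv₂⟩
  · exact absurd hv₂ (hS₁ v hv₁).2.1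
  · exact absurd ⟨hv₂.1, hv₂.2.2⟩ (hS₁ v hv₁).2.2

theorem Attached.inner_hits (ht : Attached l n t) (hl : 1 ≤ l) (h₂ : Conn S₂ (-ρ, 0) v)
    (hvz : Adj v z) (hz : z ∈ t) (hs : s ∈ nearK2 l) (h₁ : Conn S₁ s (-ρ', 0)) (hρ0 : 0 < ρ)
    (hρ : ρ < ρ') (hS₂ : ∀ v ∈ S₂, 0 ≤ v.2 ∧ v ∉ sectorH l)
    (hS₁ : ∀ v ∈ S₁, 0 ≤ v.2 ∧ v ∉ t ∧ v ∉ sectorH l) : ∃ v ∈ S₁, v ∈ S₂ := by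
  obtain ⟨I, hI⟩ : ∃ I : Set Site, I = {v | 0 ≤ v.1 ∧ 0 ≤ v.2 ∧ v.1 ≤ l ∧ v.2 ≤ l ∧
    (v.1 = 0 ∨ v.2 = l)} := ⟨_, rfl⟩
  obtain ⟨k, hk, hks⟩ : ∃ k ∈ K2 l, Adj k s := by
    rcases hs with hs | hs
    · have := (hS₁ s h₁.mem_left).2.2
      simp only [K2, sectorH, Set.mem_ofPred_eq] at hs this
      omega
    · exact hs
  simp only [K2, Set.mem_ofPred_eq] at hk
  have hIH : ∀ v ∈ I, v ∈ sectorH l := by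
    rw [hI]
    intro v hv
    simp only [sectorH, Set.mem_ofPred_eq] at hv ⊢
    omega
  have e1 : Conn (S₁ ∪ I) (0, 0) (k.1, k.2) := by
    refine Conn.ell (fun z _ _ => .inr ?_) (fun z _ _ => .inr ?_) <;>
    · rw [hI]
      simp only [Set.mem_ofPred_eq, le_refl, true_and, true_or, and_true]
      omega
  have e2 : Conn (S₁ ∪ I) s (-ρ', 0) := h₁.mono Set.subset_union_left
  obtain ⟨v, hv₁ | hv₁, hv₂⟩ := ht.separate h₂ hvz hz ((e1.tail hks e2.mem_left).trans e2).symm hρ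
    (by omega) (by omega) (fun v hv => (hS₂ v hv).1)
    (by
      rintro v (hv | hv)
      · obtain ⟨h1, h2, h3⟩ := hS₁ v hv
        refine ⟨h1, h2, ?_⟩
        simp only [sectorH, Set.mem_ofPred_eq] at h3
        omega
      · refine ⟨(hIH v hv).2.2.1, fun hvt => ?_, ?_⟩
        · have h1 := ht.sub v hvt
          have h2 := hIH v hv
          simp only [sectorH, Set.mem_ofPred_eq] at h2
          omega
        · simp only [hI, Set.mem_ofPred_eq] at hv
          omega)
  · exact ⟨v, hv₁, hv₂⟩
  · exact absurd (hIH v hv₁) (hS₂ v hv₂).2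

/-- The part of the upper half plane outside the box of radius `n`. -/
def outside (n : ℤ) : Set Site := {v | 0 ≤ v.2 ∧ (v.1 < -n ∨ n < v.1 ∨ n < v.2)}

theorem Conn.to_outside (hn : 1 ≤ n) (h : Conn S₁ s b) (hb : b ∈ boxBdry n)
    (hS₁ : ∀ v ∈ S₁, 0 ≤ v.2) : Conn (S₁ ∪ outside n) s (-(n + 1), 0) := by
  have hb2 := hS₁ b h.mem_right
  simp only [boxBdry, mem_rect, Set.mem_ofPred_eq] at hb
  have h' : Conn (S₁ ∪ outside n) s b := h.mono Set.subset_union_left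
  have e1 : Conn (S₁ ∪ outside n) (-(n + 1), 0) (n + 1, n + 1) :=
    Conn.ell (fun z _ _ => .inr (by simp only [outside, Set.mem_ofPred_eq]; omega))
      (fun z _ _ => .inr (by simp only [outside, Set.mem_ofPred_eq]; omega))
  rcases hb with ⟨hb, h1 | h1 | h1 | h1⟩
  · have e : Conn (S₁ ∪ outside n) (-(n + 1), 0) (-(n + 1), b.2) :=
      .vseg hb2 fun z _ _ => .inr (by simp only [outside, Set.mem_ofPred_eq]; omega)
    exact (h'.tail (by rw [adj_iff]; simp only [and_true]; omega) e.mem_right).trans e.symm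
  · have e : Conn (S₁ ∪ outside n) (n + 1, b.2) (n + 1, n + 1) :=
      .vseg (by omega) fun z _ _ => .inr (by simp only [outside, Set.mem_ofPred_eq]; omega)
    exact (h'.tail (by rw [adj_iff]; simp only [and_true]; omega) e.mem_left).trans
      (e.trans e1.symm)
  · omega
  · have e : Conn (S₁ ∪ outside n) (-(n + 1), 0) (b.1, n + 1) :=
      Conn.ell (fun z _ _ => .inr (by simp only [outside, Set.mem_ofPred_eq]; omega))
        (fun z _ _ => .inr (by simp only [outside, Set.mem_ofPred_eq]; omega))
    exact (h'.tail (by rw [adj_iff]; simp only [true_and]; omega) e.mem_right).trans e.symm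

theorem Attached.not_mem_outside (ht : Attached l n t) (hv : v ∈ outside n) : v ∉ t := by
  intro h
  have := ht.sub v h
  simp only [outside, Set.mem_ofPred_eq] at hv
  omega

theorem Attached.arm_hits (ht : Attached l n t) (hl : 1 ≤ l) (hln : l ≤ n) (h₂ : Conn S₂ (-ρ, 0) v)
    (hvz : Adj v z) (hz : z ∈ t) (hs : s ∈ nearK2 l) (h₁ : Conn S₁ s b) (hb : b ∈ boxBdry n)
    (hρ0 : 0 < ρ) (hρ : ρ ≤ n) (hS₂ : ∀ v ∈ S₂, v ∈ sectorH n ∧ v ∉ sectorH l)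
    (hS₁ : ∀ v ∈ S₁, 0 ≤ v.2 ∧ v ∉ t ∧ v ∉ sectorH l) : ∃ v ∈ S₁, v ∈ S₂ := by
  obtain ⟨v, hv₁ | hv₁, hv₂⟩ := ht.inner_hits hl h₂ hvz hz hs
    (h₁.to_outside (by omega) hb fun v hv => (hS₁ v hv).1) hρ0 (by omega)
    (fun v hv => ⟨(hS₂ v hv).1.2.2.1, (hS₂ v hv).2⟩)
    (by
      rintro v (hv | hv)
      · exact hS₁ v hv
      · refine ⟨hv.1, ht.not_mem_outside hv, fun h => ?_⟩
        simp only [outside, sectorH, Set.mem_ofPred_eq] at hv h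
        omega)
  · exact ⟨v, hv₁, hv₂⟩
  · have := (hS₂ v hv₂).1
    simp only [outside, sectorH, Set.mem_ofPred_eq] at hv₁ this
    omega

theorem Attached.outer_hits (ht : Attached l n t) (hl : 1 ≤ l) (hln : l ≤ n) (h₂ : Conn S₂ (-ρ, 0) v)
    (hvz : Adj v z) (hz : z ∈ t) (h₁ : Conn S₁ (c, 0) b) (hb : b ∈ boxBdry n)
    (hc : -ρ < c) (hcl : c < l) (hρ : ρ ≤ n) (hS₂ : ∀ v ∈ S₂, v ∈ sectorH n)
    (hS₁ : ∀ v ∈ S₁, 0 ≤ v.2 ∧ v ∉ t ∧ v ∉ sectorH l) : ∃ v ∈ S₁, v ∈ S₂ := by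
  obtain ⟨v, hv₁ | hv₁, hv₂⟩ := ht.separate h₂ hvz hz
    (h₁.to_outside (by omega) hb fun v hv => (hS₁ v hv).1).symm (by omega) hc hcl
    (fun v hv => (hS₂ v hv).2.2.1)
    (by
      rintro v (hv | hv)
      · obtain ⟨h1, h2, h3⟩ := hS₁ v hv
        refine ⟨h1, h2, ?_⟩
        simp only [sectorH, Set.mem_ofPred_eq] at h3
        omega
      · refine ⟨hv.1, ht.not_mem_outside hv, ?_⟩
        simp only [outside, Set.mem_ofPred_eq] at hv
        omega)
  · exact ⟨v, hv₁, hv₂⟩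
  · have := hS₂ v hv₂
    simp only [outside, sectorH, Set.mem_ofPred_eq] at hv₁ this
    omega

theorem Conn.reach {S t : Set Site} {a b : Site} (h : Conn S a b) (ha : a ∉ t) (hb : b ∈ t) :
    ∃ c d, Conn (S \ t) a c ∧ Adj c d ∧ d ∈ t := by
  obtain ⟨c, d, h1, h2, -, h3⟩ := h.exit (X := tᶜ) ha (by simpa using hb)
  exact ⟨c, d, h1, h2, by simpa using h3⟩

end Separation

/-! ### The multiplicative gain at each scale -/

/-- The part of `sectorQ n \ sectorQ l` together with the rectangle `[-r, -1] × [0, r]`, outside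
`sectorH l`. -/
def slit (l n r : ℤ) : Set Site :=
  {v | v ∈ sectorH n ∧ v ∉ sectorH l ∧ (0 ≤ v.1 ∨ -r ≤ v.1 ∧ v.2 ≤ r)}

/-- The event that there is an open path in `slit l n r`, avoiding `t`, from near `K₂` to the
boundary of the box of radius `n`. -/
def Escape (l n r : ℤ) (t : Set Site) : Set Config :=
  Crossing true (slit l n r \ t) (nearK2 l) (boxBdry n)

theorem finite_sectorH (n : ℤ) : (sectorH n).Finite :=
  finite_box (-n) n 0 n (S := sectorH n) fun _ hv => hv

theorem slit_mono {l n r r' : ℤ} (h : r ≤ r') : slit l n r ⊆ slit l n r' := by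
  rintro v ⟨h1, h2, h3⟩
  exact ⟨h1, h2, by omega⟩

theorem Attached.reach_arc {l n p q : ℤ} {t S : Set Site} {a b : Site} (ht : Attached l n t)
    (hlp : l < p) (hqn : q ≤ n) (h : Conn S a b) (hS : S ⊆ ring p q) (ha : a.1 < 0)
    (hb : 0 < b.1 ∧ b.2 = 0) : ∃ c d, Conn (S \ t) a c ∧ Adj c d ∧ d ∈ t := by
  refine h.reach (fun h' => ?_) ?_
  · have := ht.sub a h'
    omega
  · have := hS h.mem_right
    simp only [ring, Set.mem_ofPred_eq] at this
    have h2 := ht.axis b.1 (by omega) (by omega)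
    rwa [← hb.2] at h2

/-- The event that the left end of a half ring is joined to `t` by an open path. -/
def ArcTo (t : Set Site) (p q : ℤ) : Set Config :=
  Crossing true (ring p q \ t) {v | v.1 < 0 ∧ v.2 = 0} {v | ∃ z ∈ t, Adj v z}

theorem Attached.arc_subset {l n p q : ℤ} {t : Set Site} (ht : Attached l n t)
    (hlp : l < p) (hqn : q ≤ n) : Arc true p q ⊆ ArcTo t p q := by
  rintro ω ⟨a, ha, b, hb, hab⟩
  obtain ⟨c, d, h1, h2, h3⟩ := ht.reach_arc hlp hqn hab Set.inter_subset_left ha.1 hb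
  exact ⟨a, ha, c, ⟨d, h3, h2⟩, h1.mono fun v hv => ⟨⟨hv.1.1, hv.2⟩, hv.1.2⟩⟩

/-- The part of the half ring accessible from its left end when `t` is removed. -/
def leftPart (t : Set Site) (p q : ℤ) : Set Site := {v | Conn (ring p q \ t) (-p, 0) v}

/-- The event that a closed path in the right half of `leftPart` cuts `t` off from its left
half. -/
def Block (t : Set Site) (p q : ℤ) : Set Config :=
  {ω | ∃ v, ∃ z ∈ t, Adj v z ∧ Conn ({v | v ∈ leftPart t p q ∧ (0 ≤ v.1 → ω v = false)}) (-p, 0) v}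

theorem Attached.conn_left {l n p q : ℤ} {t S : Set Site} {a b : Site} (ht : Attached l n t)
    (hp : 0 < p) (hlp : l < p) (hqn : q ≤ n) (h : Conn S a b) (hS : S ⊆ ring p q) (ha : a.1 < 0 ∧ a.2 = 0)
    (hb : 0 < b.1 ∧ b.2 = 0) : ∃ v, ∃ z ∈ t, Adj v z ∧
      Conn {v | v ∈ leftPart t p q ∧ (0 ≤ v.1 → v ∈ S)} (-p, 0) v := by
  obtain ⟨c, d, h1, h2, h3⟩ := ht.reach_arc hlp hqn h hS ha.1 hb
  have har := hS h.mem_left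
  simp only [ring, Set.mem_ofPred_eq] at har
  have e : Conn {v | v ∈ ring p q \ t ∧ v.1 < 0} a (-p, 0) := by
    have : a = (a.1, 0) := Prod.ext rfl ha.2
    rw [this]
    refine .hseg (by omega) fun x h4 h5 => ⟨⟨?_, fun h6 => ?_⟩, ?_⟩
    · simp only [ring, Set.mem_ofPred_eq]
      omega
    · have := (ht.sub _ h6).1
      dsimp only at this
      omega
    · dsimp only
      omega
  refine ⟨c, d, h3, h2, ((e.symm.cluster).mono ?_).trans (h1.cluster.mono ?_)⟩
  · intro v hv
    have h4 := hv.mem_right.2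
    exact ⟨hv.mono fun w hw => hw.1, fun h5 => by omega⟩
  · intro v hv
    exact ⟨(e.symm.mono fun w hw => hw.1).trans (hv.mono fun w hw => ⟨hS hw.1, hw.2⟩),
      fun _ => hv.mem_right.1⟩

theorem Attached.arc_subset_block {l n p q : ℤ} {t : Set Site} (ht : Attached l n t)
    (hp : 0 < p) (hlp : l < p) (hqn : q ≤ n) : Arc false p q ⊆ Block t p q := by
  rintro ω ⟨a, ha, b, hb, hab⟩
  obtain ⟨c, d, h1, h2, h3⟩ := ht.conn_left hp hlp hqn hab Set.inter_subset_left ha hb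
  exact ⟨c, d, h1, h2, h3.mono fun v hv => ⟨hv.1, fun h4 => (hv.2 h4).2⟩⟩

theorem Attached.cut {l n p q : ℤ} {t : Set Site} (ht : Attached l n t)
    (hp : 0 < p) (hpq : p ≤ q) (hlp : l < p) (hqn : q ≤ n) :
    ∃ v, ∃ z ∈ t, Adj v z ∧ Conn (leftPart t p q) (-p, 0) v := by
  have e1 : Conn (ring p q) (-p, 0) (p, p) := .ell
    (fun z _ _ => by simp only [ring, Set.mem_ofPred_eq]; omega)
    (fun z _ _ => by simp only [ring, Set.mem_ofPred_eq]; omega)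
  have e2 : Conn (ring p q) (p, 0) (p, p) := .vseg hp.le
    (fun z _ _ => by simp only [ring, Set.mem_ofPred_eq]; omega)
  obtain ⟨c, d, h1, h2, h3⟩ := ht.conn_left hp hlp hqn (e1.trans e2.symm) subset_rfl (by simpa using hp)
    (by simpa using hp)
  exact ⟨c, d, h1, h2, h3.mono fun v hv => hv.1⟩

theorem loc_block {t : Set Site} {p q : ℤ} : Loc {v ∈ leftPart t p q | 0 ≤ v.1} (Block t p q) := by
  rintro ω ω' h ⟨v, z, hz, hvz, hv⟩
  exact ⟨v, z, hz, hvz, hv.mono fun w hw => ⟨hw.1, fun h0 => (h w ⟨hw.1, h0⟩).symm.trans (hw.2 h0)⟩⟩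

section Step

variable {l n r : ℤ} {t : Set Site} {ω : Config}

theorem Attached.escape_inter_block (ht : Attached l n t) (hl : 1 ≤ l) (hlr : l ≤ r)
    (hrn : 64 * r ≤ n) : Escape l n r t ∩ Block t (8 * r) (12 * r) = ∅ := by
  rw [Set.eq_empty_iff_forall_notMem]
  rintro ω ⟨⟨s, hs, b, hb, h₁⟩, v, z, hz, hvz, h₂⟩
  obtain ⟨w, hw₁, hw₂⟩ := ht.arm_hits hl (by omega) h₂ hvz hz hs h₁ hb (by omega) (by omega)
    (by
      rintro w ⟨hw, -⟩
      have := hw.mem_right.1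
      simp only [ring, sectorH, Set.mem_ofPred_eq] at this ⊢
      omega)
    (fun w hw => ⟨hw.1.1.1.2.2.1, hw.1.2, hw.1.1.2.1⟩)
  have h1 := hw₁.1.1.2.2
  have h2 := hw₂.1.mem_right.1
  simp only [ring, Set.mem_ofPred_eq] at h2
  have h3 := hw₂.2 (by omega)
  have h4 := hw₁.2
  simp only [Set.mem_ofPred_eq, h3] at h4
  exact absurd h4 (by decide)

/-- The event that the part of the arm before the first visit to `M` is present. -/
def InnerArm (l n r : ℤ) (t M : Set Site) : Set Config :=
  Crossing true ((slit l n r \ t) \ M) (nearK2 l) {v | ∃ w ∈ M, Adj v w}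

/-- The event that the part of the arm after the last visit to `M` is present. -/
def OuterArm (l n r : ℤ) (t M : Set Site) : Set Config :=
  Crossing true ((slit l n r \ t) \ M) {v | ∃ w ∈ M, Adj v w} (boxBdry n)

theorem Attached.escape_subset (ht : Attached l n t) (hl : 1 ≤ l) (hlr : l ≤ r)
    (hrn : 64 * r ≤ n) {M : Set Site} (hM : M = {v ∈ leftPart t (8 * r) (12 * r) | 0 ≤ v.1}) :
    Escape l n r t ⊆ InnerArm l n r t M ∩ OuterArm l n r t M := by
  rintro ω ⟨s, hs, b, hb, h₁⟩
  obtain ⟨v, z, hz, hvz, h₂⟩ := ht.cut (p := 8 * r) (q := 12 * r) (by omega) (by omega) (by omega)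
    (by omega)
  obtain ⟨w, hw₁, hw₂⟩ := ht.arm_hits hl (by omega) h₂ hvz hz hs h₁.cluster hb (by omega) (by omega)
    (by
      intro w hw
      have := hw.mem_right.1
      simp only [ring, sectorH, Set.mem_ofPred_eq] at this ⊢
      omega)
    (fun w hw => ⟨hw.mem_right.1.1.1.2.2.1, hw.mem_right.1.2, hw.mem_right.1.1.2.1⟩)
  have hMr : ∀ v ∈ M, v ∈ ring (8 * r) (12 * r) := by
    rw [hM]
    exact fun v hv => hv.1.mem_right.1
  have hwM : w ∈ M := by
    rw [hM]
    refine ⟨hw₂, ?_⟩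
    have h1 := hw₁.mem_right.1.1.2.2
    have h2 := hw₂.mem_right.1
    simp only [ring, Set.mem_ofPred_eq] at h2
    omega
  have hsM : s ∉ M := by
    intro h
    have := hMr s h
    rcases hs with hs | ⟨u, hu, hus⟩
    · simp only [ring, K2, Set.mem_ofPred_eq] at this hs
      omega
    · rw [adj_iff] at hus
      simp only [ring, K2, Set.mem_ofPred_eq] at this hu
      omega
  have hbM : b ∉ M := by
    intro h
    have := hMr b h
    simp only [ring, boxBdry, mem_rect, Set.mem_ofPred_eq] at this hb
    omega
  refine ⟨?_, ?_⟩
  · obtain ⟨c, d, h1, h2, -, h3⟩ := hw₁.exit (X := Mᶜ) hsM (by simpa using hwM)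
    exact ⟨s, hs, c, ⟨d, by simpa using h3, h2⟩, h1.mono fun v hv => ⟨⟨hv.1.1, hv.2⟩, hv.1.2⟩⟩
  · obtain ⟨c, d, -, h1, h2, h3⟩ := (hw₁.symm.trans h₁).last_exit hwM hbM
    exact ⟨d, ⟨c, h1, h2.symm⟩, b, hb, h3.mono fun v hv => ⟨⟨hv.1.1, hv.2⟩, hv.1.2⟩⟩

/-- Crossing of a long rectangle on the left of the slit. -/
def Bypass (r : ℤ) : Set Config :=
  Crossing true (rect (-(48 * r)) (-(2 * r)) 0 r) {v | v.1 = -(48 * r)} {v | v.1 = -(2 * r)}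

theorem Attached.bypass_hits (ht : Attached l n t) (hl : 1 ≤ l) (hr : 1 ≤ r) {S₁ S₂ : Set Site}
    {a b v z : Site} {p q : ℤ} (hp : 2 * r ≤ p) (hq : q ≤ 48 * r)
    (h₁ : Conn S₁ a b) (hS₁ : S₁ ⊆ rect (-(48 * r)) (-(2 * r)) 0 r)
    (ha : a.1 = -(48 * r)) (hb : b.1 = -(2 * r)) {ρ : ℤ} (h₂ : Conn S₂ (-ρ, 0) v) (hvz : Adj v z) (hz : z ∈ t)
    (hS₂ : S₂ ⊆ ring p q) (hρ : 0 < ρ) : ∃ v ∈ S₁, v ∈ S₂ := by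
  have hρ' := hS₂ h₂.mem_left
  simp only [ring, Set.mem_ofPred_eq] at hρ'
  obtain ⟨X, hX⟩ : ∃ X : Set Site, X = {v | 0 ≤ v.2 ∧ v.2 ≤ r ∧
    (v.1 = -(48 * r + 1) ∨ v.1 = -(2 * r) + 1)} := ⟨_, rfl⟩
  have ha2 := hS₁ h₁.mem_left
  have hb2 := hS₁ h₁.mem_right
  rw [mem_rect] at ha2 hb2
  have e1 : Conn (S₁ ∪ X) (-(48 * r + 1), 0) (-(48 * r + 1), a.2) := by
    refine .vseg (by omega) fun y _ _ => .inr ?_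
    rw [hX]
    simp only [Set.mem_ofPred_eq, true_or, and_true]
    omega
  have e2 : Conn (S₁ ∪ X) (-(2 * r) + 1, 0) (-(2 * r) + 1, b.2) := by
    refine .vseg (by omega) fun y _ _ => .inr ?_
    rw [hX]
    simp only [Set.mem_ofPred_eq, or_true, and_true]
    omega
  have e := h₁.mono (Set.subset_union_left (t := X))
  have e3 := (e1.tail (by rw [adj_iff]; simp only [and_true]; omega) e.mem_left).trans
    ((e.tail (by rw [adj_iff]; simp only [and_true]; omega) e2.mem_right).trans e2.symm)
  obtain ⟨w, hw₁ | hw₁, hw₂⟩ := ht.separate h₂ hvz hz e3 (by omega) (by omega) (by omega)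
    (fun v hv => (hS₂ hv).1)
    (by
      have : ∀ v ∈ S₁ ∪ X, 0 ≤ v.2 ∧ v.1 < 0 := by
        rintro v (hv | hv)
        · have := hS₁ hv
          rw [mem_rect] at this
          omega
        · rw [hX] at hv
          simp only [Set.mem_ofPred_eq] at hv
          omega
      intro v hv
      obtain ⟨h1, h2⟩ := this v hv
      refine ⟨h1, fun h3 => ?_, by omega⟩
      have := ht.sub v h3
      omega)
  · exact ⟨w, hw₁, hw₂⟩
  · have h1 := hS₂ hw₂
    rw [hX] at hw₁
    simp only [ring, Set.mem_ofPred_eq] at h1 hw₁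
    omega

theorem Attached.arms_subset (ht : Attached l n t) (hl : 1 ≤ l) (hlr : l ≤ r)
    (hrn : 64 * r ≤ n) {M : Set Site} (hM : M = {v ∈ leftPart t (8 * r) (12 * r) | 0 ≤ v.1}) :
    (InnerArm l n r t M ∩ OuterArm l n r t M) ∩ (ArcTo t (2 * r) (3 * r) ∩
      (ArcTo t (32 * r) (48 * r) ∩ Bypass r)) ⊆ Escape l n (64 * r) t := by
  rintro ω ⟨⟨⟨s, hs, a₁, ⟨w₁, hw₁, haw₁⟩, h₁⟩, a₂, ⟨w₂, hw₂, haw₂⟩, b, hb, h₂⟩,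
    ⟨⟨a₃, a₃'⟩, ⟨ha₃, ha₃'⟩, b₃, ⟨z₃, hz₃, hbz₃⟩, h₃⟩, ⟨⟨a₄, a₄'⟩, ⟨ha₄, ha₄'⟩, b₄, ⟨z₄, hz₄, hbz₄⟩, h₄⟩,
    a₅, ha₅, b₅, hb₅, h₅⟩
  dsimp only at ha₃ ha₃' ha₄ ha₄'
  subst ha₃' ha₄'
  rw [hM] at hw₁ hw₂
  obtain ⟨ρ, rfl⟩ : ∃ ρ, a₃ = -ρ := ⟨-a₃, by omega⟩
  obtain ⟨ρ', rfl⟩ : ∃ ρ, a₄ = -ρ := ⟨-a₄, by omega⟩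
  have hρ := h₃.mem_left.1.1
  have hρ' := h₄.mem_left.1.1
  simp only [ring, Set.mem_ofPred_eq] at hρ hρ'
  obtain ⟨C, hC⟩ : ∃ C, C = leftPart t (8 * r) (12 * r) := ⟨_, rfl⟩
  have hCr : ∀ v ∈ C, v ∈ ring (8 * r) (12 * r) ∧ v ∉ t := by
    rw [hC]
    exact fun v hv => hv.mem_right
  have c₁ : Conn C (-(8 * r), 0) w₁ := by
    rw [hC]
    exact hw₁.1.cluster
  have c₂ : Conn C (-(8 * r), 0) w₂ := by
    rw [hC]
    exact hw₂.1.cluster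
  have hslit : ∀ v ∈ slit l n r \ t, 0 ≤ v.2 ∧ v ∉ t ∧ v ∉ sectorH l :=
    fun v hv => ⟨hv.1.1.2.2.1, hv.2, hv.1.2.1⟩
  have hC' : ∀ v ∈ C, 0 ≤ v.2 ∧ v ∉ t ∧ v ∉ sectorH l := by
    intro v hv
    obtain ⟨h1, h2⟩ := hCr v hv
    simp only [ring, sectorH, Set.mem_ofPred_eq] at h1 ⊢
    refine ⟨h1.1, h2, ?_⟩
    omega
  have i₁ : Conn ({v | Conn ((slit l n r \ t) \ M ∩ {v | ω v = true}) s v} ∪ C) s (-(8 * r), 0) :=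
    ((h₁.cluster.mono Set.subset_union_left).tail haw₁ (.inr c₁.mem_right)).trans
      (c₁.symm.mono Set.subset_union_right)
  obtain ⟨x, hx | hx, hx₃⟩ := ht.inner_hits hl h₃.cluster hbz₃ hz₃ hs i₁ (by omega) (by omega)
    (by
      intro v hv
      have := hv.mem_right.1.1
      simp only [ring, sectorH, Set.mem_ofPred_eq] at this ⊢
      omega)
    (by
      rintro v (hv | hv)
      exacts [hslit v hv.mem_right.1.1, hC' v hv])
  swap
  · have h1 := (hCr x hx).1
    have h2 := hx₃.mem_right.1.1
    simp only [ring, Set.mem_ofPred_eq] at h1 h2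
    omega
  have i₂ : Conn ({v | Conn ((slit l n r \ t) \ M ∩ {v | ω v = true}) a₂ v} ∪ C) (-(8 * r), 0) b :=
    ((c₂.mono Set.subset_union_right).tail haw₂.symm (.inl (.refl h₂.mem_left))).trans
      (h₂.cluster.mono Set.subset_union_left)
  obtain ⟨y, hy | hy, hy₄⟩ := ht.outer_hits hl (by omega) h₄.cluster hbz₄ hz₄ i₂ hb (by omega) (by omega)
    (by omega)
    (by
      intro v hv
      have := hv.mem_right.1.1
      simp only [ring, sectorH, Set.mem_ofPred_eq] at this ⊢
      omega)
    (by
      rintro v (hv | hv)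
      exacts [hslit v hv.mem_right.1.1, hC' v hv])
  swap
  · have h1 := (hCr y hy).1
    have h2 := hy₄.mem_right.1.1
    simp only [ring, Set.mem_ofPred_eq] at h1 h2
    omega
  obtain ⟨x', hx'₅, hx'₃⟩ := ht.bypass_hits hl (by omega) (p := 2 * r) (q := 3 * r) le_rfl (by omega)
    h₅.cluster (fun v hv => hv.mem_right.1) ha₅ hb₅ h₃.cluster hbz₃ hz₃
    (fun v hv => hv.mem_right.1.1) (by omega)
  obtain ⟨y', hy'₅, hy'₄⟩ := ht.bypass_hits hl (by omega) (p := 32 * r) (q := 48 * r) (by omega) le_rfl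
    h₅.cluster (fun v hv => hv.mem_right.1) ha₅ hb₅ h₄.cluster hbz₄ hz₄
    (fun v hv => hv.mem_right.1.1) (by omega)
  have s₁ : (slit l n r \ t) \ M ∩ {v | ω v = true} ⊆ slit l n (64 * r) \ t ∩ {v | ω v = true} :=
    fun v hv => ⟨⟨slit_mono (by omega) hv.1.1.1, hv.1.1.2⟩, hv.2⟩
  have s₃ : (ring (2 * r) (3 * r) \ t) ∩ {v | ω v = true} ⊆ slit l n (64 * r) \ t ∩ {v | ω v = true} := by
    refine Set.inter_subset_inter_left _ (Set.sdiff_subset_sdiff_left fun v hv => ?_)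
    simp only [ring, slit, sectorH, Set.mem_ofPred_eq] at hv ⊢
    omega
  have s₄ : (ring (32 * r) (48 * r) \ t) ∩ {v | ω v = true} ⊆ slit l n (64 * r) \ t ∩ {v | ω v = true} := by
    refine Set.inter_subset_inter_left _ (Set.sdiff_subset_sdiff_left fun v hv => ?_)
    simp only [ring, slit, sectorH, Set.mem_ofPred_eq] at hv ⊢
    omega
  have s₅ : rect (-(48 * r)) (-(2 * r)) 0 r ∩ {v | ω v = true} ⊆ slit l n (64 * r) \ t ∩ {v | ω v = true} := by
    refine Set.inter_subset_inter_left _ fun v hv => ⟨?_, fun h => ?_⟩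
    · simp only [mem_rect, slit, sectorH, Set.mem_ofPred_eq] at hv ⊢
      omega
    · rw [mem_rect] at hv
      have := ht.sub v h
      omega
  exact ⟨s, hs, b, hb, (hx.mono s₁).trans <| (hx₃.symm.mono s₃).trans <| (hx'₃.mono s₃).trans <|
    (hx'₅.symm.mono s₅).trans <| (hy'₅.mono s₅).trans <| (hy'₄.symm.mono s₄).trans <|
    (hy₄.mono s₄).trans <| (hy.symm.mono s₁).trans (h₂.mono s₁)⟩

end Step

/-- Enlarging the slit by a constant factor increases the escape probability by a constant
factor. -/
theorem escape_step : ∃ c : ℝ, 0 < c ∧ ∀ μ : Measure Config, IsBernoulliHalf μ →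
    ∀ (l n r : ℤ) (t : Set Site), Attached l n t → 1 ≤ l → l ≤ r → 2 ≤ r → 64 * r ≤ n →
      (1 + c) * μ.real (Escape l n r t) ≤ μ.real (Escape l n (64 * r) t) := by
  obtain ⟨ca, hca, harc⟩ := arc_ge
  obtain ⟨cb, hcb, hrect⟩ := rect_crossing
  refine ⟨ca * (ca * cb) * ca, by positivity, fun μ hμ l n r t ht hl hlr hr hrn => ?_⟩
  have := hμ.1
  obtain ⟨M, hM⟩ : ∃ M : Set Site, M = {v ∈ leftPart t (8 * r) (12 * r) | 0 ≤ v.1} := ⟨_, rfl⟩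
  have hMr : ∀ v ∈ M, v ∈ ring (8 * r) (12 * r) := by
    rw [hM]
    exact fun v hv => hv.1.mem_right.1
  obtain ⟨Λ, hΛ⟩ : ∃ Λ : Set Site, Λ = sectorH n \ M := ⟨_, rfl⟩
  have hfin : Λ.Finite := hΛ ▸ (finite_sectorH n).subset Set.sdiff_subset
  have hfinM : M.Finite := (finite_ring (8 * r) (12 * r)).subset hMr
  have hring : ∀ p q : ℤ, 0 ≤ p → q ≤ n → (q < 8 * r ∨ 12 * r < p) → ring p q \ t ⊆ Λ := by
    intro p q hp hq h v hv
    rw [hΛ]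
    have h1 := hv.1
    refine ⟨?_, fun h2 => ?_⟩
    · simp only [ring, sectorH, Set.mem_ofPred_eq] at h1 ⊢
      omega
    · have h3 := hMr v h2
      simp only [ring, Set.mem_ofPred_eq] at h1 h3
      omega
  have l₃ : Loc Λ (ArcTo t (2 * r) (3 * r)) :=
    Crossing.loc.mono (hring _ _ (by omega) (by omega) (by omega))
  have l₄ : Loc Λ (ArcTo t (32 * r) (48 * r)) :=
    Crossing.loc.mono (hring _ _ (by omega) (by omega) (by omega))
  have l₅ : Loc Λ (Bypass r) := by
    refine Crossing.loc.mono fun v hv => ?_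
    rw [mem_rect] at hv
    rw [hΛ, hM]
    refine ⟨?_, fun h => ?_⟩
    · simp only [sectorH, Set.mem_ofPred_eq]
      omega
    · have := h.2
      omega
  have hslit : (slit l n r \ t) \ M ⊆ Λ := by
    rw [hΛ]
    exact fun v hv => ⟨hv.1.1.1, hv.2⟩
  have l₁ : Loc Λ (InnerArm l n r t M ∩ OuterArm l n r t M) :=
    (Crossing.loc.mono hslit).inter (Crossing.loc.mono hslit)
  have p₃ : ca ≤ μ.real (ArcTo t (2 * r) (3 * r)) :=
    (harc μ hμ r hr true).trans (measureReal_mono (ht.arc_subset (by omega) (by omega)))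
  have p₄ : ca ≤ μ.real (ArcTo t (32 * r) (48 * r)) := by
    have h1 := harc μ hμ (16 * r) (by omega) true
    rw [show 2 * (16 * r) = 32 * r by ring, show 3 * (16 * r) = 48 * r by ring] at h1
    exact h1.trans (measureReal_mono (ht.arc_subset (by omega) (by omega)))
  have p₅ : cb ≤ μ.real (Bypass r) :=
    (hrect μ hμ r (-(48 * r)) (-(2 * r)) 0 r hr (by omega) (by omega) (by omega)).1
  have pB : ca ≤ μ.real (Block t (8 * r) (12 * r)) := by
    have h1 := harc μ hμ (4 * r) (by omega) false
    rw [show 2 * (4 * r) = 8 * r by ring, show 3 * (4 * r) = 12 * r by ring] at h1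
    exact h1.trans (measureReal_mono (ht.arc_subset_block (by omega) (by omega) (by omega)))
  have h45 := Measure.real_harris_mul hμ hfin l₄ l₅ Crossing.incr Crossing.incr p₄ p₅ hcb.le
  have h345 := Measure.real_harris_mul hμ hfin l₃ (l₄.inter l₅) Crossing.incr
    (Crossing.incr.inter Crossing.incr) p₃ h45 (by positivity)
  have hJ := Measure.real_harris_mul hμ hfin l₁ (l₃.inter (l₄.inter l₅))
    (Crossing.incr.inter Crossing.incr) (Crossing.incr.inter (Crossing.incr.inter Crossing.incr))
    (measureReal_mono (ht.escape_subset hl hlr hrn hM)) h345 (by positivity)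
  have lB : Loc M (Block t (8 * r) (12 * r)) := hM ▸ loc_block
  have hind := hμ.indep hfin hfinM (hΛ ▸ Set.disjoint_sdiff_left)
    (l₁.inter (l₃.inter (l₄.inter l₅))) lB
  have hJB := mul_le_mul hJ pB hca.le measureReal_nonneg
  rw [← hind] at hJB
  have hEfin : (slit l n r \ t).Finite := (finite_sectorH n).subset fun v hv => hv.1.1
  have hdisj : Disjoint (Escape l n r t) (((InnerArm l n r t M ∩ OuterArm l n r t M) ∩
      (ArcTo t (2 * r) (3 * r) ∩ (ArcTo t (32 * r) (48 * r) ∩ Bypass r))) ∩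
        Block t (8 * r) (12 * r)) := by
    rw [Set.disjoint_iff]
    rintro ω ⟨h1, -, h2⟩
    have h3 : ω ∈ Escape l n r t ∩ Block t (8 * r) (12 * r) := ⟨h1, h2⟩
    rwa [ht.escape_inter_block hl hlr hrn] at h3
  have hsum := measureReal_union (μ := μ) hdisj.symm (Crossing.loc.measurableSet hEfin)
  have hmono : μ.real (((InnerArm l n r t M ∩ OuterArm l n r t M) ∩
      (ArcTo t (2 * r) (3 * r) ∩ (ArcTo t (32 * r) (48 * r) ∩ Bypass r))) ∩
        Block t (8 * r) (12 * r) ∪ Escape l n r t) ≤ μ.real (Escape l n (64 * r) t) := by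
    refine measureReal_mono (Set.union_subset (fun ω hω => ht.arms_subset hl hlr hrn hM hω.1) ?_)
    exact Crossing.mono (Set.sdiff_subset_sdiff_left (slit_mono (by omega))) subset_rfl subset_rfl
  nlinarith

/-! ### The lowest open cluster in the quadrant -/

/-- The quarter annulus. -/
def quadrant (l n : ℤ) : Set Site := sectorQ n \ sectorQ l

/-- The sites just below the quarter annulus, and the part of the right side of the inner box
below `K₁`. -/
def lowerArc (l n : ℤ) : Set Site :=
  {v | (v.2 = -1 ∧ l ≤ v.1 ∧ v.1 ≤ n) ∨ (v.1 = l ∧ -1 ≤ v.2 ∧ 8 * v.2 < 3 * l)}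

/-- The upper part of the inner box, together with the sites to the left of the quadrant above
`K₁`. -/
def upperArc (l n : ℤ) : Set Site :=
  {v | 5 * l < 8 * v.2 ∧ (0 ≤ v.1 ∧ v.1 ≤ l ∧ v.2 ≤ l ∨ v.1 = -1 ∧ v.2 ≤ n)}

/-- The open clusters adjacent to the lower arc. -/
def lowCluster (l n : ℤ) (ω : Config) : Set Site :=
  clusterOf true (quadrant l n) (nbhd (quadrant l n) (lowerArc l n)) ω

/-- The sites revealed by exploring the open clusters adjacent to the lower arc. -/
def lowExplored (l n : ℤ) (ω : Config) : Set Site :=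
  explored true (quadrant l n) (nbhd (quadrant l n) (lowerArc l n)) ω

/-- The event that the open clusters of the lower arc do not reach the upper arc. -/
def Separated (l n : ℤ) : Set Config :=
  {ω | ∀ a ∈ lowCluster l n ω, ∀ u ∈ upperArc l n, ¬ Adj a u}

section Quadrant

variable {l n : ℤ} {ω : Config}

theorem mem_quadrant {v : Site} : v ∈ quadrant l n ↔
    (0 ≤ v.1 ∧ v.1 ≤ n ∧ 0 ≤ v.2 ∧ v.2 ≤ n) ∧ ¬ (0 ≤ v.1 ∧ v.1 ≤ l ∧ 0 ≤ v.2 ∧ v.2 ≤ l) := Iff.rfl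

theorem quadrant_subset : quadrant l n ⊆ sectorH n \ sectorH l := by
  intro v hv
  rw [mem_quadrant] at hv
  simp only [sectorH, Set.mem_sdiff, Set.mem_ofPred_eq]
  omega

theorem lowExplored_subset : lowExplored l n ω ⊆ quadrant l n :=
  explored_subset fun _ hv => hv.1

theorem attached_lowExplored (hl : 1 ≤ l) : Attached l n (lowExplored l n ω) := by
  have hax : ∀ x, l < x → x ≤ n → (x, 0) ∈ lowExplored l n ω := by
    intro x h1 h2
    refine .inl ⟨?_, (x, -1), ?_, ?_⟩
    · rw [mem_quadrant]
      dsimp only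
      omega
    · simp only [lowerArc, Set.mem_ofPred_eq, true_and]
      omega
    · rw [adj_iff]
      simp
  refine ⟨fun v hv => ?_, fun v hv => ?_, hax⟩
  · have := lowExplored_subset hv
    rw [mem_quadrant] at this
    omega
  · obtain ⟨a, ⟨ha, u, hu, hua⟩, hav⟩ := conn_explored hv
    refine (hav.symm.mono Set.subset_union_left).trans ?_
    rw [adj_iff] at hua
    rw [mem_quadrant] at ha
    simp only [lowerArc, Set.mem_ofPred_eq] at hu
    by_cases h0 : a.2 = 0
    · have e : Conn (lowExplored l n ω ∪ {v | v.1 = l ∧ 0 ≤ v.2 ∧ 8 * v.2 < 3 * l}) (l, 0) (a.1, 0) := by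
        refine .hseg (by omega) fun x h1 h2 => ?_
        by_cases hx : x = l
        · right
          simp only [Set.mem_ofPred_eq, hx, true_and]
          omega
        · exact .inl (hax x (by omega) (by omega))
      have ha0 : a = (a.1, 0) := Prod.ext rfl h0
      rw [ha0]
      exact e.symm
    · have e : Conn (lowExplored l n ω ∪ {v | v.1 = l ∧ 0 ≤ v.2 ∧ 8 * v.2 < 3 * l}) (l, 0) u := by
        have : u = (l, u.2) := Prod.ext (by dsimp only; omega) rfl
        rw [this]
        refine .vseg (by omega) fun y _ _ => .inr ?_
        simp only [Set.mem_ofPred_eq, true_and]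
        omega
      exact (e.tail (by rw [adj_iff]; exact hua) (.inl (hav.mem_left))).symm

theorem separated_congr {ω' : Config} (h : ∀ v ∈ lowExplored l n ω, ω v = ω' v)
    (hω : ω ∈ Separated l n) : ω' ∈ Separated l n := by
  intro a ha
  rw [lowCluster, clusterOf_congr h] at ha
  exact hω a ha

theorem mem_separated_of_closed_arm (hl : 1 ≤ l) (hln : l ≤ n) {s k b : Site}
    (h : Conn (quadrant l n ∩ {v | ω v = false}) s b) (hk : k ∈ K1 l) (hks : Adj k s)
    (hb : b ∈ boxBdry n) : ω ∈ Separated l n := by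
  intro a ha u hu hau
  simp only [K1, Set.mem_ofPred_eq] at hk
  have hbD := h.mem_right.1
  rw [mem_quadrant] at hbD
  simp only [boxBdry, mem_rect, Set.mem_ofPred_eq] at hb
  simp only [upperArc, Set.mem_ofPred_eq] at hu
  obtain ⟨X, hX⟩ : ∃ X : Set Site, X = {v | -1 ≤ v.2 ∧
    (v.2 = k.2 ∧ -1 ≤ v.1 ∧ v.1 ≤ l ∨ v.1 = -1 ∧ v.2 ≤ k.2 ∨ v.1 = n + 1 ∨
      0 ≤ v.1 ∧ v.2 = n + 1)} := ⟨_, rfl⟩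
  obtain ⟨Y, hY⟩ : ∃ Y : Set Site, Y = {v | v ∈ upperArc l n ∨ v.1 = -2 ∧ -1 ≤ v.2 ∨
    v ∈ lowerArc l n} := ⟨_, rfl⟩
  obtain ⟨S, hS⟩ : ∃ S : Set Site, S = quadrant l n ∩ {v | ω v = false} ∪ X := ⟨_, rfl⟩
  obtain ⟨S', hS'⟩ : ∃ S : Set Site, S = lowCluster l n ω ∪ Y := ⟨_, rfl⟩
  have hXS : ∀ v ∈ X, v ∈ S := fun v hv => hS ▸ .inr hv
  have hYS : ∀ v ∈ Y, v ∈ S' := fun v hv => hS' ▸ .inr hv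
  have e₁ : Conn S (-1, -1) (l, k.2) := .ell
    (fun z _ _ => hXS _ (by rw [hX]; simp only [Set.mem_ofPred_eq, true_and]; omega))
    (fun z _ _ => hXS _ (by rw [hX]; simp only [Set.mem_ofPred_eq, true_and]; omega))
  have e₂ : Conn S s b := h.mono (hS ▸ Set.subset_union_left)
  have e₃ : ∃ d, Conn S (n + 1, -1) d ∧ Adj b d := by
    by_cases hbn : b.1 = n
    · refine ⟨(n + 1, b.2), .vseg (by omega) fun y _ _ => hXS _ ?_, ?_⟩
      · rw [hX]
        simp only [Set.mem_ofPred_eq, true_or, or_true, and_true]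
        omega
      · rw [adj_iff]
        simp only [and_true]
        omega
    · refine ⟨(b.1, n + 1), .ell (fun y _ _ => hXS _ ?_) (fun y _ _ => hXS _ ?_), ?_⟩
      · rw [hX]
        simp only [Set.mem_ofPred_eq, true_or, or_true, and_true]
        omega
      · rw [hX]
        simp only [Set.mem_ofPred_eq, and_true]
        omega
      · rw [adj_iff]
        simp only [true_and]
        omega
  obtain ⟨d, e₃, hbd⟩ := e₃
  have hk' : k = (l, k.2) := Prod.ext hk.1 rfl
  have e := (e₁.tail (hk' ▸ hks) e₂.mem_left).trans ((e₂.tail hbd e₃.mem_right).trans e₃.symm)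
  have f₁ : Conn S' (-2, -1) u := by
    refine Conn.ell (p := u.1) (q := u.2) (fun z _ _ => hYS _ ?_) (fun z _ _ => hYS _ ?_)
    · rw [hY]
      simp only [Set.mem_ofPred_eq, true_and]
      omega
    · rw [hY]
      simp only [upperArc, Set.mem_ofPred_eq]
      omega
  obtain ⟨a', ⟨ha', w, hw, hwa'⟩, f₂⟩ := conn_clusterOf ha
  have f₂' : Conn S' a' a := f₂.mono (hS' ▸ Set.subset_union_left)
  have f₃ : Conn S' (l, -1) w := by
    have hwY : w ∈ Y := hY ▸ .inr (.inr hw)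
    simp only [lowerArc, Set.mem_ofPred_eq] at hw
    refine Conn.ell (p := w.1) (q := w.2) (fun z _ _ => hYS _ ?_) (fun z _ _ => hYS _ ?_)
    · rw [hY]
      simp only [lowerArc, Set.mem_ofPred_eq, true_and]
      omega
    · rw [hY]
      simp only [lowerArc, Set.mem_ofPred_eq]
      omega
  have f := (f₁.tail hau.symm f₂'.mem_right).trans (f₂'.symm.trans
    (.head hwa'.symm f₂'.mem_left f₃.symm))
  obtain ⟨v, hv', hv⟩ := f.halfPlane_cross e (by omega) (by omega) (by omega)
    (by
      rw [hS', hY]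
      rintro v (hv | hv)
      · have := (clusterOf_subset hv).1
        rw [mem_quadrant] at this
        omega
      · simp only [upperArc, lowerArc, Set.mem_ofPred_eq] at hv
        omega)
    (by
      rw [hS, hX]
      rintro v (hv | hv)
      · have := hv.1
        rw [mem_quadrant] at this
        omega
      · exact hv.1)
  rw [hS, hX] at hv
  rw [hS', hY] at hv'
  have hD : ∀ v ∈ Y, v ∉ quadrant l n := by
    rw [hY]
    intro v hv h
    rw [mem_quadrant] at h
    simp only [upperArc, lowerArc, Set.mem_ofPred_eq] at hv
    omega
  rcases hv' with hv' | hv' <;> rcases hv with hv | hv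
  · have h1 := (clusterOf_subset hv').2
    have h2 := hv.2
    simp only [Set.mem_ofPred_eq] at h1 h2
    simp [h1] at h2
  · have h1 := (clusterOf_subset hv').1
    rw [mem_quadrant] at h1
    simp only [Set.mem_ofPred_eq] at hv
    omega
  · exact hD v (hY ▸ hv') hv.1
  · simp only [upperArc, lowerArc, Set.mem_ofPred_eq] at hv hv'
    omega

theorem escape_of_open_arm (hl : 1 ≤ l) (hω : ω ∈ Separated l n) {s b : Site}
    (h : Conn (quadrant l n ∩ {v | ω v = true}) s b) (hs : s ∈ nearK2 l) (hb : b ∈ boxBdry n) :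
    ω ∈ Escape l n l (lowExplored l n ω) := by
  refine ⟨s, hs, b, hb, h.cluster.mono fun v hv => ⟨⟨?_, fun hvT => ?_⟩, hv.mem_right.2⟩⟩
  · have h1 := hv.mem_right.1
    have h2 := quadrant_subset h1
    exact ⟨h2.1, h2.2, .inl h1.1.1⟩
  · obtain ⟨a, ha, hav⟩ := mem_clusterOf_of_mem_explored hvT hv.mem_right.1 hv.mem_right.2
    have hsA : s ∈ lowCluster l n ω := ⟨a, ha, hav.trans hv.symm⟩
    have hsD := h.mem_left.1
    rcases hs with hs | ⟨u, hu, hus⟩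
    · rw [mem_quadrant] at hsD
      simp only [K2, Set.mem_ofPred_eq] at hs
      omega
    · refine hω s hsA u ?_ hus.symm
      simp only [K2, upperArc, Set.mem_ofPred_eq] at hu ⊢
      omega

theorem exists_closed_arm (hl : 1 ≤ l) (hln : 2 * l ≤ n) (hω : ω ∈ Separated l n)
    (hK : (K1 l).Nonempty) : ∃ k s b, k ∈ K1 l ∧ Adj k s ∧ b ∈ boxBdry n ∧
      Conn (quadrant l n ∩ {v | ω v = false}) s b := by
  obtain ⟨k, hk₁, hk₂, hk₃⟩ : ∃ k : ℤ, 3 * l ≤ 8 * k ∧ 8 * k ≤ 5 * l ∧ 8 * (k - 1) < 3 * l := by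
    obtain ⟨k, -, h1, h2⟩ := hK
    have h3 : -(-(3 * l) / 8) ≤ k.2 := by omega
    exact ⟨-(-(3 * l) / 8), by omega, by omega, by omega⟩
  obtain ⟨a, b, c, hab, hbc, hac, ha, hb, hc₁, hc₂, hcD, hc⟩ := exists_triple_point
    (D := quadrant l n)
    (O₁ := {v | -1 ≤ v.1 ∧ -1 ≤ v.2 ∧ (v.2 = -1 ∧ v.1 ≤ n ∨ v.1 ≤ l ∧ 8 * v.2 < 3 * l)})
    (O₂ := {v | -1 ≤ v.1 ∧ v.1 ≤ l ∧ 3 * l ≤ 8 * v.2 ∧ 8 * v.2 ≤ 5 * l}) ω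
    (x₀ := -1) (x₁ := n + 1) (y₀ := -1) (y₁ := n + 1) (k := k)
    (by omega) (by omega) (by omega)
    (by simp only [Set.mem_ofPred_eq]; intros; omega)
    (by simp only [mem_quadrant, Set.mem_ofPred_eq]; intros; omega)
    (by simp only [mem_quadrant, Set.mem_ofPred_eq]; intros; omega)
    (by simp only [mem_quadrant]; intros; omega)
    (by simp only [Set.mem_ofPred_eq]; intros; omega)
    (by simp only [Set.mem_ofPred_eq]; intros; omega)
    (by simp only [Set.mem_ofPred_eq]; intros; omega)
    (by simp only [Set.mem_ofPred_eq]; intros; omega)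
    (by simp only [Set.mem_ofPred_eq]; intros; omega)
    (by simp only [Set.mem_ofPred_eq, le_refl, true_and]; omega)
    (by simp only [Set.mem_ofPred_eq, le_refl, true_and]; omega)
  rw [mem_quadrant] at hcD
  have hcU : c ∉ upperArc l n := by
    intro hcU
    rcases ha with ha | ⟨a', ⟨ha'D, u, hu, hua'⟩, ha⟩
    · rw [adj_iff] at hac
      simp only [upperArc, Set.mem_ofPred_eq] at ha hcU
      have h1 : a.2 < k := by omega
      have h2 : k < c.2 := by omega
      omega
    · refine hω a ⟨a', ⟨ha'D, u, ?_, hua'⟩, ha⟩ c hcU hac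
      rw [adj_iff] at hua'
      rw [mem_quadrant] at ha'D
      simp only [lowerArc, Set.mem_ofPred_eq] at hu ⊢
      omega
  simp only [upperArc, Set.mem_ofPred_eq] at hcU hc₁ hc₂
  have hcn : c.1 = n + 1 ∨ c.2 = n + 1 := by omega
  rw [adj_iff] at hbc
  rcases hb with hb | ⟨s, ⟨hsD, u, hu, hus⟩, hb⟩
  · simp only [Set.mem_ofPred_eq] at hb
    omega
  · refine ⟨u, s, b, ?_, hus, ?_, hb⟩
    · rw [adj_iff] at hus
      rw [mem_quadrant] at hsD
      simp only [K1, Set.mem_ofPred_eq] at hu ⊢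
      omega
    · have := hb.mem_right.1
      rw [mem_quadrant] at this
      simp only [boxBdry, mem_rect, Set.mem_ofPred_eq]
      omega

end Quadrant

theorem conn_of_pathIn {S : Set Site} {p : List Site} {s b : Site} (ω : Config) (c : Bool)
    (hp : PathIn S p) (hc : ∀ v ∈ p, ω v = c) (hs : p.head? = some s) (hb : p.getLast? = some b) :
    Conn (S ∩ {v | ω v = c}) s b :=
  .of_list hp.1.2.2 (fun v hv => ⟨hp.2 v hv, hc v hv⟩) hs hb

theorem zeta_sectorQ_subset {l n : ℤ} (hl : 1 ≤ l) (hln : l ≤ n) {ω : Config}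
    (h : zeta sectorQ l n ω) : (K1 l).Nonempty ∧
      ω ∈ Separated l n ∩ {ω | ω ∈ Escape l n l (lowExplored l n ω)} := by
  obtain ⟨⟨p, hp, hpc, ⟨s, hs, hsK⟩, b, hb, hpb⟩, q, hq, hqo, ⟨s', hs', hsK'⟩, b', hb', hqb'⟩ := h
  have h₁ : Conn (quadrant l n ∩ {v | ω v = false}) s b := conn_of_pathIn ω false hp hpc hs hpb
  have h₂ : Conn (quadrant l n ∩ {v | ω v = true}) s' b' := conn_of_pathIn ω true hq hqo hs' hqb'
  obtain ⟨k, hk, hks⟩ : ∃ k ∈ K1 l, Adj k s := by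
    rcases hsK with hsK | hsK
    · have h3 := h₁.mem_left.1
      rw [mem_quadrant] at h3
      simp only [K1, Set.mem_ofPred_eq] at hsK
      omega
    · exact hsK
  have hω := mem_separated_of_closed_arm hl hln h₁ hk hks hb
  have hesc := escape_of_open_arm hl hω h₂ hsK' hb'
  exact ⟨⟨k, hk⟩, hω, hesc⟩

theorem zeta_sectorH_of_mem {l n r : ℤ} (hl : 1 ≤ l) (hln : 2 * l ≤ n) (hK : (K1 l).Nonempty)
    {ω : Config} (h : ω ∈ Separated l n ∩ {ω | ω ∈ Escape l n r (lowExplored l n ω)}) :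
    zeta sectorH l n ω := by
  obtain ⟨hω, s', hs', b', hb', h₂⟩ := h
  obtain ⟨k, s, b, hk, hks, hb, h₁⟩ := exists_closed_arm hl hln hω hK
  obtain ⟨p, ⟨hp, hpS⟩, hps, hpb⟩ := h₁.exists_list
  obtain ⟨q, ⟨hq, hqS⟩, hqs, hqb⟩ := h₂.exists_list
  refine ⟨⟨p, ⟨hp, fun v hv => quadrant_subset (hpS v hv).1⟩, fun v hv => (hpS v hv).2,
    ⟨s, hps, .inr ⟨k, hk, hks⟩⟩, b, hb, hpb⟩, q, ⟨hq, fun v hv => ?_⟩, fun v hv => (hqS v hv).2,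
    ⟨s', hqs, hs'⟩, b', hb', hqb⟩
  have := (hqS v hv).1.1
  exact ⟨this.1, this.2.1⟩

/-- The comparison of the two sectors, when the outer radius is at least `64 ^ K` times the inner
one. -/
theorem zeta_gain : ∃ c : ℝ, 0 < c ∧ ∀ μ : Measure Config, IsBernoulliHalf μ →
    ∀ (l n : ℤ) (K : ℕ), 1 ≤ l → 2 * l ≤ n → 64 ^ K * l ≤ n →
      (1 + c) ^ K * μ.real {ω | zeta sectorQ l n ω} ≤ μ.real {ω | zeta sectorH l n ω} := by
  obtain ⟨c, hc, hstep⟩ := escape_step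
  refine ⟨c, hc, fun μ hμ l n K hl hln hK => ?_⟩
  have := hμ.1
  by_cases hK1 : (K1 l).Nonempty
  swap
  · have : {ω | zeta sectorQ l n ω} = ∅ := by
      rw [Set.eq_empty_iff_forall_notMem]
      exact fun ω hω => hK1 (zeta_sectorQ_subset hl (by omega) hω).1
    rw [this, measureReal_empty, mul_zero]
    exact measureReal_nonneg
  have hl2 : 2 ≤ l := by
    obtain ⟨k, -, h1, h2⟩ := hK1
    omega
  have key : ∀ j ≤ K, (1 + c) ^ j * μ.real {ω | zeta sectorQ l n ω} ≤
      μ.real (Separated l n ∩ {ω | ω ∈ Escape l n (64 ^ j * l) (lowExplored l n ω)}) := by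
    intro j
    induction j with
    | zero =>
      intro _
      rw [pow_zero, pow_zero, one_mul, one_mul]
      exact measureReal_mono fun ω hω => (zeta_sectorQ_subset hl (by omega) hω).2
    | succ j ih =>
      intro hj
      have hpow : (64 : ℤ) ^ (j + 1) ≤ 64 ^ K := pow_le_pow_right₀ (by norm_num) hj
      have hpow' : (1 : ℤ) ≤ 64 ^ j := one_le_pow₀ (by norm_num)
      have h1 : (64 : ℤ) ^ (j + 1) * l = 64 * (64 ^ j * l) := by rw [pow_succ]; ring
      have h2 : (64 : ℤ) ^ (j + 1) * l ≤ n := (mul_le_mul_of_nonneg_right hpow (by omega)).trans hK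
      have h3 : l ≤ 64 ^ j * l := le_mul_of_one_le_left (by omega) hpow'
      have h4 := hμ.explore (finite_sectorH n) (T := lowExplored l n) (G := Separated l n)
        (E := Escape l n (64 ^ j * l)) (F := Escape l n (64 ^ (j + 1) * l)) (k := 1 + c)
        (fun ω v hv => (quadrant_subset (lowExplored_subset hv)).1)
        (fun ω ω' h => explored_congr h) (fun ω ω' h => separated_congr h)
        (fun t => Crossing.loc.mono fun v hv => ⟨hv.1.1, hv.2⟩)
        (fun t => Crossing.loc.mono fun v hv => ⟨hv.1.1, hv.2⟩)
        (fun ω _ => by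
          rw [h1]
          exact hstep μ hμ l n _ _ (attached_lowExplored hl) hl h3 (by omega) (by omega))
      refine le_trans ?_ h4
      rw [pow_succ', mul_assoc]
      exact mul_le_mul_of_nonneg_left (ih (by omega)) (by positivity)
  exact (key K le_rfl).trans (measureReal_mono fun ω hω => zeta_sectorH_of_mem hl hln hK1 hω)

/-- There exist constants `α > 0` and `C < ∞` such that uniformly for integers
`1 ≤ l ≤ n/2`, `P(ζ(π/2,l,n)) ≤ C·(n/l)^{-α}·P(ζ(π,l,n))`. -/
theorem statement4 :
    ∃ α : ℝ, 0 < α ∧ ∃ C : ℝ≥0∞, C < ⊤ ∧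
      ∀ μ : Measure Config, IsBernoulliHalf μ →
        ∀ l n : ℕ, 1 ≤ l → 2 * l ≤ n →
          μ {ω | zeta sectorQ l n ω} ≤
            C * ((n : ℝ≥0∞) / (l : ℝ≥0∞)) ^ (-α) * μ {ω | zeta sectorH l n ω} := by
  obtain ⟨c, hc, h⟩ := zeta_gain
  refine ⟨Real.log (1 + c) / Real.log 64, div_pos (Real.log_pos (by linarith)) (Real.log_pos (by norm_num)),
    ENNReal.ofReal (1 + c), ENNReal.ofReal_lt_top, fun μ hμ l n hl hln => ?_⟩
  have := hμ.1
  obtain ⟨α, hα⟩ : ∃ α : ℝ, α = Real.log (1 + c) / Real.log 64 := ⟨_, rfl⟩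
  rw [← hα]
  have hα0 : 0 ≤ α := by
    rw [hα]
    exact (div_pos (Real.log_pos (by linarith)) (Real.log_pos (by norm_num))).le
  have h64 : (64 : ℝ) ^ α = 1 + c := by
    rw [hα, Real.rpow_def_of_pos (by norm_num), mul_div_cancel₀ _ (Real.log_pos (by norm_num)).ne',
      Real.exp_log (by linarith)]
  obtain ⟨K, hK⟩ : ∃ K, K = Nat.log 64 (n / l) := ⟨_, rfl⟩
  have hnl : n / l ≠ 0 := (Nat.div_pos (by omega) (by omega)).ne'
  have hK₁ : 64 ^ K * l ≤ n := by
    rw [hK]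
    exact (Nat.le_div_iff_mul_le (by omega)).1 (Nat.pow_log_le_self 64 hnl)
  have hK₂ : n < 64 ^ (K + 1) * l := by
    rw [hK]
    exact (Nat.div_lt_iff_lt_mul (by omega)).1 (Nat.lt_pow_succ_log_self (by norm_num) _)
  have hl0 : (0 : ℝ) < l := by exact_mod_cast hl
  have hn0 : (0 : ℝ) < n := by
    have : 0 < n := by omega
    exact_mod_cast this
  have hx : 0 < (n / l : ℝ) := div_pos hn0 hl0
  have hgain := h μ hμ l n K (by exact_mod_cast hl) (by exact_mod_cast hln) (by exact_mod_cast hK₁)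
  have hxK : (n / l : ℝ) ^ α ≤ (1 + c) ^ (K + 1) := by
    have h1 : (n / l : ℝ) ≤ 64 ^ (K + 1) := by
      rw [div_le_iff₀ hl0]
      exact_mod_cast hK₂.le
    calc (n / l : ℝ) ^ α ≤ ((64 : ℝ) ^ (K + 1)) ^ α := Real.rpow_le_rpow hx.le h1 hα0
      _ = (1 + c) ^ (K + 1) := by
        rw [← h64, ← Real.rpow_natCast, ← Real.rpow_mul (by norm_num), mul_comm, Real.rpow_mul (by norm_num),
          Real.rpow_natCast]
  have hreal : μ.real {ω | zeta sectorQ l n ω} ≤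
      (1 + c) * (n / l : ℝ) ^ (-α) * μ.real {ω | zeta sectorH l n ω} := by
    have hxα : 0 < (n / l : ℝ) ^ α := Real.rpow_pos_of_pos hx α
    rw [Real.rpow_neg hx.le, mul_right_comm, ← div_eq_mul_inv, le_div_iff₀ hxα]
    calc μ.real {ω | zeta sectorQ l n ω} * (n / l : ℝ) ^ α
        ≤ μ.real {ω | zeta sectorQ l n ω} * (1 + c) ^ (K + 1) :=
          mul_le_mul_of_nonneg_left hxK measureReal_nonneg
      _ = (1 + c) * ((1 + c) ^ K * μ.real {ω | zeta sectorQ l n ω}) := by ring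
      _ ≤ _ := mul_le_mul_of_nonneg_left hgain (by linarith)
  have e := ENNReal.ofReal_le_ofReal hreal
  rw [ENNReal.ofReal_mul (by positivity), ENNReal.ofReal_mul (by linarith), ofReal_measureReal,
    ofReal_measureReal, ← ENNReal.ofReal_rpow_of_pos hx, ENNReal.ofReal_div_of_pos hl0,
    ENNReal.ofReal_natCast, ENNReal.ofReal_natCast] at e
  exact e
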